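/- arXiv:1908.11793 — 7 statements merged into one kernel-verified Lean document; each statement's English description precedes it below -/
import Mathlib

section
/- Let p be a prime, q = p^r with r ≥ 1, let L : 𝔽_q → 𝔽_q be an 𝔽_p-linear map, let k > 1 be an integer and D = p^{⌊log_p k⌋+1}. Then for every β ∈ 𝔽_q, the real sequence (1/q^n) · #{x ∈ 𝔽_q^n : L(e_k(x)) = β} converges as n → ∞, and its limit equals D^{−(q−1)} · #{ b : 𝔽_q^× → {0,1,…,D−1} : L(esymm_k(M_b)) = β }. -/
open Filter Topology

/-- The elementary symmetric polynomial of degree `k` evaluated at `x ∈ K^n`. -/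
def evalE {K : Type*} [CommSemiring K] {n : ℕ} (k : ℕ) (x : Fin n → K) : K :=
  (Multiset.map x Finset.univ.val).esymm k

/-- `Mb b` is the multiset containing each nonzero (unit) `α` with multiplicity `b α`. -/
def Mb {K : Type*} [Monoid K] [Fintype K] [DecidableEq K] {D : ℕ}
    (b : Kˣ → Fin D) : Multiset K :=
  ∑ α : Kˣ, Multiset.replicate (b α : ℕ) (α : K)

theorem char_map_sum {G ι : Type*} [AddCommGroup G] (χ : AddChar G ℂ) (t : Finset ι) (f : ι → G) :
    χ (∑ i ∈ t, f i) = ∏ i ∈ t, χ (f i) := by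
  classical
  induction t using Finset.induction_on with
  | empty => simp
  | insert a t ha ih => rw [Finset.sum_insert ha, Finset.prod_insert ha, AddChar.map_add_eq_mul, ih]

theorem fin_nsmul_one {D : ℕ} [NeZero D] (a : Fin D) : (a : ℕ) • (1 : Fin D) = a := by
  have h : ∀ m : ℕ, ((m • (1 : Fin D) : Fin D) : ℕ) = m % D := by
    intro m
    induction m with
    | zero => simp
    | succ m ih => rw [succ_nsmul, Fin.val_add, ih, Fin.val_one', ← Nat.add_mod]
  ext
  rw [h, Nat.mod_eq_of_lt a.isLt]

theorem norm_sum_lt {A : Type*} [Fintype A] [DecidableEq A] (f : A → ℂ) (hf : ∀ a, ‖f a‖ = 1)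
    (a b : A) (ha : f a = 1) (hb : f b ≠ 1) : ‖∑ c, f c‖ < Fintype.card A := by
  have hab : b ∈ Finset.univ.erase a := by
    simp only [Finset.mem_erase, Finset.mem_univ, and_true]
    rintro rfl
    exact hb ha
  have h1 : ‖f a + f b‖ < ‖f a‖ + ‖f b‖ := by
    apply norm_add_lt_of_not_sameRay
    intro h
    have := (sameRay_iff_of_norm_eq (by rw [hf, hf])).1 h
    exact hb (this ▸ ha)
  have h2 : ‖∑ c ∈ (Finset.univ.erase a).erase b, f c‖ ≤
      ∑ c ∈ (Finset.univ.erase a).erase b, ‖f c‖ := norm_sum_le _ _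
  have h3 : (∑ c, ‖f c‖) = Fintype.card A := by simp [hf]
  rw [← h3, ← Finset.add_sum_erase _ _ (Finset.mem_univ a), ← Finset.add_sum_erase _ _ hab,
    ← Finset.add_sum_erase _ (fun c => ‖f c‖) (Finset.mem_univ a),
    ← Finset.add_sum_erase _ (fun c => ‖f c‖) hab, ← add_assoc, ← add_assoc]
  calc _ ≤ _ := norm_add_le _ _
    _ < _ := by linarith

theorem tendsto_walk {G A : Type*} [AddCommGroup G] [Fintype G] [DecidableEq G] [Fintype A]
    [DecidableEq A] (s : A → G) (a0 : A) (h0 : s a0 = 0)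
    (hs : ∀ χ : AddChar G ℂ, (∀ a, χ (s a) = 1) → χ = 0) (g : G) :
    Tendsto (fun n : ℕ =>
      ((Finset.univ.filter (fun x : Fin n → A => ∑ i, s (x i) = g)).card : ℝ) /
        (Fintype.card A : ℝ) ^ n) atTop (𝓝 (1 / Fintype.card G)) := by
  have hA : (Fintype.card A : ℂ) ≠ 0 := by
    have : Nonempty A := ⟨a0⟩
    exact_mod_cast Fintype.card_ne_zero
  have hG : (Fintype.card G : ℂ) ≠ 0 := by exact_mod_cast Fintype.card_ne_zero
  have hcount : ∀ n : ℕ,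
      ((Finset.univ.filter (fun x : Fin n → A => ∑ i, s (x i) = g)).card : ℂ) =
      (∑ χ : AddChar G ℂ, χ (-g) * (∑ a, χ (s a)) ^ n) / Fintype.card G := by
    intro n
    rw [eq_div_iff hG]
    have : ∀ χ : AddChar G ℂ, χ (-g) * (∑ a, χ (s a)) ^ n =
        ∑ x : Fin n → A, χ (∑ i, s (x i) - g) := by
      intro χ
      rw [Fintype.sum_pow, Finset.mul_sum]
      refine Finset.sum_congr rfl fun x _ => ?_
      rw [sub_eq_neg_add, AddChar.map_add_eq_mul, char_map_sum]
    simp_rw [this]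
    rw [Finset.sum_comm]
    simp_rw [AddChar.sum_apply_eq_ite, sub_eq_zero]
    rw [← Finset.sum_filter, Finset.sum_const, nsmul_eq_mul]
  have hlim : Tendsto (fun n : ℕ =>
      (∑ χ : AddChar G ℂ, χ (-g) * ((∑ a, χ (s a)) / Fintype.card A) ^ n) / Fintype.card G)
      atTop (𝓝 ((∑ χ : AddChar G ℂ, if χ = 0 then 1 else 0) / Fintype.card G)) := by
    refine Tendsto.div_const (tendsto_finsetSum _ fun χ _ => ?_) _
    split_ifs with hχ
    · subst hχ
      simp [hA]
    · rw [← mul_zero (χ (-g))]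
      refine Tendsto.const_mul _ (tendsto_pow_atTop_nhds_zero_of_norm_lt_one ?_)
      have : ∃ a, χ (s a) ≠ 1 := by
        by_contra! h
        exact hχ (hs χ h)
      obtain ⟨b, hb⟩ := this
      rw [norm_div, Complex.norm_natCast, div_lt_one]
      · exact norm_sum_lt (fun a => χ (s a)) (fun a => AddChar.norm_apply _ _) a0 b
          (by simp [h0]) hb
      · exact_mod_cast Fintype.card_pos_iff.2 ⟨a0⟩
  rw [← tendsto_ofReal_iff]
  convert hlim using 2 with n
  · push_cast
    rw [hcount, div_right_comm, Finset.sum_div]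
    simp_rw [div_pow, mul_div_assoc]
  · simp

theorem char_ext {K : Type*} [Field K] [Fintype K] [DecidableEq K] {D : ℕ} [NeZero D]
    (χ : AddChar (Kˣ → Fin D) ℂ)
    (h : ∀ a : K, χ (fun β : Kˣ => if a = β then (1 : Fin D) else 0) = 1) : χ = 0 := by
  ext g
  have : g = ∑ α : Kˣ, (g α : ℕ) • (fun β : Kˣ => if (α : K) = β then (1 : Fin D) else 0) := by
    ext β : 1
    rw [Finset.sum_apply, Finset.sum_eq_single β]
    · simpa using (fin_nsmul_one (g β)).symm
    · intro b _ hb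
      simp [Units.val_inj, hb]
    · simp
  rw [this, char_map_sum]
  simp [AddChar.map_nsmul_eq_pow, h]

section
open Polynomial
theorem coeff_gen {K : Type*} [CommRing K] (s : Multiset K) : ∀ k : ℕ,
    ((s.map (fun a => (1 + C a * X : K[X]))).prod).coeff k = s.esymm k := by
  induction s using Multiset.induction with
  | empty =>
    intro k
    cases k <;> simp [Multiset.esymm, Polynomial.coeff_one, Multiset.powersetCard_zero_right]
  | cons a s ih =>
    intro k
    rw [Multiset.map_cons, Multiset.prod_cons, add_mul, one_mul, coeff_add, ih, mul_assoc,
      coeff_C_mul]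
    cases k with
    | zero => simp [Multiset.esymm]
    | succ k =>
      rw [coeff_X_mul, ih]
      simp [Multiset.esymm, Multiset.powersetCard_cons, Multiset.map_map,
        Multiset.sum_map_mul_left]

theorem phi_sum {K R : Type*} [Field K] [Fintype K] [DecidableEq K] [CommRing R] {D : ℕ} [NeZero D]
    (u : K → R) (h0 : u 0 = 1) (hu : ∀ a, u a ^ D = 1) {n : ℕ} (x : Fin n → K) :
    ∏ α : Kˣ, u α ^ ((∑ i, (fun β : Kˣ => if x i = β then (1 : Fin D) else 0)) α : ℕ) =
      ∏ i, u (x i) := by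
  let Φ : Multiplicative (Kˣ → Fin D) →* R :=
    { toFun := fun b => ∏ α : Kˣ, u α ^ (b.toAdd α : ℕ)
      map_one' := by simp
      map_mul' := by
        intro b c
        rw [← Finset.prod_mul_distrib]
        refine Finset.prod_congr rfl fun α _ => ?_
        rw [toAdd_mul, Pi.add_apply, Fin.val_add, ← pow_eq_pow_mod _ (hu _), pow_add] }
  have key : ∀ a : K, Φ (Multiplicative.ofAdd (fun β : Kˣ => if a = β then (1 : Fin D) else 0))
      = u a := by
    intro a
    change ∏ α : Kˣ, u α ^ ((if a = α then (1 : Fin D) else 0 : Fin D) : ℕ) = u a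
    by_cases ha : a = 0
    · subst ha
      rw [h0]
      refine Finset.prod_eq_one fun α _ => ?_
      rw [if_neg α.ne_zero.symm]; simp
    · rw [Finset.prod_eq_single (Units.mk0 a ha)]
      · rw [if_pos (by simp), Fin.val_one', ← pow_eq_pow_mod _ (hu _), pow_one]; simp
      · intro b _ hb
        rw [if_neg]
        · simp
        · rintro rfl
          exact hb (by ext; simp)
      · simp
  have := map_prod Φ (fun i => Multiplicative.ofAdd
    (fun β : Kˣ => if x i = β then (1 : Fin D) else 0)) Finset.univ
  simp only [key] at this
  rw [← this, ← ofAdd_sum]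
  rfl

theorem evalE_eq {p k : ℕ} (hp : p.Prime) {K : Type*} [Field K] [Fintype K] [DecidableEq K] [CharP K p]
    {m : ℕ} [NeZero (p ^ m)] (hD : k < p ^ m) {n : ℕ} (x : Fin n → K) :
    (Multiset.map x Finset.univ.val).esymm k =
    (∑ α : Kˣ, Multiset.replicate
      ((∑ i, (fun β : Kˣ => if x i = β then (1 : Fin (p ^ m)) else 0)) α : ℕ) (α : K)).esymm k := by
  have := Fact.mk hp
  have h := phi_sum (D := p ^ m)
    (fun a : K => Ideal.Quotient.mk (Ideal.span {(X : K[X]) ^ (k+1)}) (1 + C a * X))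
    (by simp) (by
      intro a
      rw [← map_pow, ← map_one (Ideal.Quotient.mk _), Ideal.Quotient.mk_eq_mk_iff_sub_mem,
        Ideal.mem_span_singleton, add_pow_char_pow, mul_pow]
      simp only [one_pow, add_sub_cancel_left]
      exact Dvd.dvd.mul_left (pow_dvd_pow _ hD) _) x
  simp only [← map_pow, ← map_prod] at h
  rw [Ideal.Quotient.mk_eq_mk_iff_sub_mem, Ideal.mem_span_singleton, X_pow_dvd_iff] at h
  have h2 := h k (Nat.lt_succ_self k)
  rw [coeff_sub, sub_eq_zero] at h2
  rw [← coeff_gen, ← coeff_gen, ← Multiset.coe_mapAddMonoidHom, map_sum, Multiset.prod_sum]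
  simp only [Multiset.coe_mapAddMonoidHom, Multiset.map_replicate, Multiset.prod_replicate]
  rw [h2, Multiset.map_map]
  rfl

end

/-- Let `q = p^r`, `L : 𝔽_q → 𝔽_q` be `𝔽_p`-linear (equivalently, additive),
`k > 1` and `D = p^(⌊log_p k⌋ + 1)`.  Then for every `β ∈ 𝔽_q` the sequence
`(1/q^n) ⬝ #{x ∈ 𝔽_q^n : L(e_k(x)) = β}` converges as `n → ∞` to
`D^(-(q-1)) ⬝ #{b : 𝔽_qˣ → {0,…,D-1} : L(esymm_k(M_b)) = β}`. -/
theorem tendsto_prob_esymm (p r : ℕ) (hp : p.Prime) (hr : 1 ≤ r)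
    (K : Type*) [Field K] [Fintype K] [DecidableEq K] (hK : Fintype.card K = p ^ r)
    (L : K →+ K) (k : ℕ) (hk : 1 < k) (β : K) :
    Tendsto
      (fun n : ℕ =>
        ((Finset.univ.filter (fun x : Fin n → K => L (evalE k x) = β)).card : ℝ) /
          ((p : ℝ) ^ r) ^ n)
      atTop
      (𝓝 (((Finset.univ.filter
          (fun b : Kˣ → Fin (p ^ (Nat.log p k + 1)) => L ((Mb b).esymm k) = β)).card : ℝ) /
        ((p : ℝ) ^ (Nat.log p k + 1)) ^ (p ^ r - 1))) := by
  have hpos : NeZero (p ^ (Nat.log p k + 1)) := ⟨pow_ne_zero _ hp.ne_zero⟩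
  have hchar : CharP K p := by
    obtain ⟨p', hp'⟩ := CharP.exists K
    obtain ⟨n, hn1, hn2⟩ := FiniteField.card K p'
    rw [hK] at hn2
    have : p = p' := by
      have hd : p ∣ p' ^ (n : ℕ) := hn2 ▸ dvd_pow_self p (by omega)
      exact (Nat.prime_dvd_prime_iff_eq hp hn1).1 (hp.dvd_of_dvd_pow hd)
    rwa [this]
  have hD : k < p ^ (Nat.log p k + 1) := Nat.lt_pow_succ_log_self hp.one_lt k
  let s : K → (Kˣ → Fin (p ^ (Nat.log p k + 1))) := fun a β => if a = β then 1 else 0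
  have hev : ∀ (n : ℕ) (x : Fin n → K), evalE k x = (Mb (∑ i, s (x i))).esymm k :=
    fun n x => evalE_eq hp hD x
  have hw := tendsto_walk s 0 (by
    funext β
    exact if_neg β.ne_zero.symm) char_ext
  have hsum := tendsto_finsetSum (Finset.univ.filter
    (fun b : Kˣ → Fin (p ^ (Nat.log p k + 1)) => L ((Mb b).esymm k) = β)) (fun g _ => hw g)
  convert hsum using 2 with n
  · rw [← Finset.sum_div, hK]
    push_cast
    congr 1
    rw [Finset.card_eq_sum_card_fiberwise (f := fun x : Fin n → K => ∑ i, s (x i))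
      (t := Finset.univ.filter
        (fun b : Kˣ → Fin (p ^ (Nat.log p k + 1)) => L ((Mb b).esymm k) = β))]
    · push_cast
      refine Finset.sum_congr rfl fun g hg => ?_
      rw [Finset.mem_filter] at hg
      congr 2
      ext x
      simp only [Finset.mem_filter, Finset.mem_univ, true_and, hev]
      constructor
      · exact fun h => h.2
      · intro h
        rw [h]
        exact ⟨hg.2, rfl⟩
    · intro x hx
      simpa [hev] using hx
  · rw [Finset.sum_const, nsmul_eq_mul, Fintype.card_fun, Fintype.card_units, hK, Fintype.card_fin]
    push_cast
    rw [mul_one_div]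
end

section
/- Let p be a prime, q = p^r with r ≥ 1, let L : 𝔽_q → 𝔽_q be an 𝔽_p-linear map, let 0 < k_1 < ⋯ < k_s be integers with k_s > 1, let c_1, …, c_s ∈ 𝔽_q, and set D = p^{⌊log_p k_s⌋+1}. Then for every γ ∈ 𝔽_q, the real sequence (1/q^n) · #{x ∈ 𝔽_q^n : L(∑_{t=1}^{s} c_t · e_{k_t}(x)) = γ} converges as n → ∞, and its limit equals D^{−(q−1)} · #{ b : 𝔽_q^× → {0,1,…,D−1} : L(∑_{t=1}^{s} c_t · esymm_{k_t}(M_b)) = γ }. -/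
open Filter Topology

theorem aux_coeff {K : Type*} [CommRing K] (s : Multiset K) (k : ℕ) :
    (s.map (fun a => 1 + Polynomial.C a * Polynomial.X)).prod.coeff k = s.esymm k := by
  induction s using Multiset.induction_on generalizing k with
  | empty =>
    cases k with
    | zero => simp [Multiset.esymm]
    | succ k =>
      have h : Multiset.powersetCard (k + 1) (0 : Multiset K) = 0 :=
        Multiset.powersetCard_eq_empty _ (by simp)
      simp [Multiset.esymm, Polynomial.coeff_one, h]
  | cons a s ih =>
    rw [Multiset.map_cons, Multiset.prod_cons, add_mul, one_mul, Polynomial.coeff_add, ih,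
      mul_assoc, Polynomial.coeff_C_mul]
    cases k with
    | zero => simp [Multiset.esymm]
    | succ k =>
      rw [Polynomial.coeff_X_mul, ih]
      simp [Multiset.esymm, Multiset.powersetCard_cons, Multiset.sum_map_mul_left]

theorem aux_map_sum {G ι : Type*} [AddCommGroup G] (ψ : AddChar G ℂ) (s : Finset ι) (f : ι → G) :
    ψ (∑ i ∈ s, f i) = ∏ i ∈ s, ψ (f i) := by
  classical
  induction s using Finset.induction_on with
  | empty => simp
  | insert a s ha ih => rw [Finset.sum_insert ha, Finset.prod_insert ha,
      AddChar.map_add_eq_mul, ih]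

theorem aux_limit {G K : Type*} [AddCommGroup G] [Fintype G] [DecidableEq G] [Fintype K]
    (e : K → G) (a0 : K) (he0 : e a0 = 0)
    (hgen : ∀ ψ : AddChar G ℂ, (∀ a, ψ (e a) = 1) → ψ = 0) (g : G) :
    Tendsto (fun n : ℕ => ((Finset.univ.filter (fun x : Fin n → K => ∑ i, e (x i) = g)).card : ℝ)
      / (Fintype.card K : ℝ) ^ n) atTop (𝓝 (1 / Fintype.card G)) := by
  classical
  have hq : (Fintype.card K : ℂ) ≠ 0 := by
    have : Nonempty K := ⟨a0⟩
    exact_mod_cast Fintype.card_ne_zero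
  have hG : (Fintype.card G : ℂ) ≠ 0 := by
    exact_mod_cast Fintype.card_ne_zero
  have key : ∀ n : ℕ, ((Finset.univ.filter
      (fun x : Fin n → K => ∑ i, e (x i) = g)).card : ℂ) / (Fintype.card K : ℂ) ^ n =
      (∑ ψ : AddChar G ℂ, ψ (-g) * ((∑ a, ψ (e a)) / Fintype.card K) ^ n) / Fintype.card G := by
    intro n
    have h1 : ((Finset.univ.filter
      (fun x : Fin n → K => ∑ i, e (x i) = g)).card : ℂ) * Fintype.card G =
        ∑ ψ : AddChar G ℂ, ψ (-g) * (∑ a, ψ (e a)) ^ n := by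
      simp_rw [Fintype.sum_pow, Finset.mul_sum]
      rw [Finset.sum_comm]
      have : ∀ x : Fin n → K, ∑ ψ : AddChar G ℂ, ψ (-g) * ∏ i, ψ (e (x i)) =
          if ∑ i, e (x i) = g then (Fintype.card G : ℂ) else 0 := by
        intro x
        have h2 := AddChar.sum_apply_eq_ite (-g + ∑ i, e (x i))
        simp only [AddChar.map_add_eq_mul, aux_map_sum] at h2
        rw [h2]
        congr 1
        rw [neg_add_eq_zero]
        exact propext eq_comm
      simp_rw [this]
      rw [← Finset.sum_filter, Finset.sum_const, nsmul_eq_mul]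
    simp_rw [div_pow, mul_div_assoc']
    rw [← Finset.sum_div, ← h1]
    field_simp
  have hlim : Tendsto (fun n : ℕ => (∑ ψ : AddChar G ℂ,
      ψ (-g) * ((∑ a, ψ (e a)) / Fintype.card K) ^ n) / Fintype.card G) atTop
      (𝓝 ((∑ ψ : AddChar G ℂ, if ψ = 0 then 1 else 0) / Fintype.card G)) := by
    refine Tendsto.div_const (tendsto_finsetSum _ fun ψ _ => ?_) _
    split_ifs with h
    · subst h
      simp [hq]
    · obtain ⟨a1, ha1⟩ : ∃ a, ψ (e a) ≠ 1 := by
        by_contra! hc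
        exact h (hgen ψ hc)
      have hne : a0 ≠ a1 := by
        rintro rfl
        simp [he0] at ha1
      have hlt : ‖(∑ a, ψ (e a)) / (Fintype.card K : ℂ)‖ < 1 := by
        have hqr : (0 : ℝ) < Fintype.card K := by
          have : Nonempty K := ⟨a0⟩
          exact_mod_cast Fintype.card_pos
        have := norm_sum_lt_of_strictConvexSpace (V := ℂ) (t := Finset.univ)
          (w := fun _ : K => 1 / (Fintype.card K : ℝ)) (r := 1) (z := fun a => ψ (e a))
          (i := a0) (j := a1)
          (by intros; positivity) (by simp [hqr.ne'])
          (by simp) (by simp) (by simpa [he0] using ha1.symm) (by positivity) (by positivity)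
          (by simp)
        rw [← Finset.smul_sum] at this
        simpa [div_eq_inv_mul] using this
      simpa using (tendsto_pow_atTop_nhds_zero_of_norm_lt_one hlt).const_mul (ψ (-g))
  have hlim2 : Tendsto (fun n : ℕ => ((Finset.univ.filter
      (fun x : Fin n → K => ∑ i, e (x i) = g)).card : ℂ) / (Fintype.card K : ℂ) ^ n) atTop
      (𝓝 (1 / Fintype.card G)) := by
    simp_rw [key]
    simpa using hlim
  have h3 : Tendsto (fun n : ℕ => ((((Finset.univ.filter
      (fun x : Fin n → K => ∑ i, e (x i) = g)).card : ℝ) / (Fintype.card K : ℝ) ^ n : ℝ) : ℂ))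
      atTop (𝓝 ((1 / Fintype.card G : ℝ) : ℂ)) := by
    simpa using hlim2
  exact (Complex.continuous_re.tendsto _).comp h3

theorem aux_esymm (p d : ℕ) [Fact p.Prime] {K : Type*} [Field K] [CharP K p] [Fintype K]
    [DecidableEq K] {n : ℕ} (x : Fin n → K) (b : Kˣ → Fin (p ^ d))
    (h : ∀ u : Kˣ, (Finset.univ.filter (fun i => x i = u)).card ≡ b u [MOD p ^ d])
    (k : ℕ) (hk : k < p ^ d) : evalE k x = (Mb b).esymm k := by
  unfold evalE
  rw [← aux_coeff, ← aux_coeff]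
  have hdvd : (Polynomial.X : Polynomial K) ^ (p ^ d) ∣
      ((Multiset.map x Finset.univ.val).map
        (fun a => 1 + Polynomial.C a * Polynomial.X)).prod -
      ((Mb b).map (fun a => 1 + Polynomial.C a * Polynomial.X)).prod := by
    rw [← Ideal.mem_span_singleton, ← Ideal.Quotient.eq]
    set φ := Ideal.Quotient.mk (Ideal.span {(Polynomial.X : Polynomial K) ^ (p ^ d)})
    have hone : ∀ u : K, (φ (1 + Polynomial.C u * Polynomial.X)) ^ (p ^ d) = 1 := by
      intro u
      rw [← map_pow, add_pow_char_pow, one_pow, mul_pow, map_add, map_one, map_mul φ,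
        (Ideal.Quotient.eq_zero_iff_mem.2 (Ideal.mem_span_singleton_self _) :
          φ (Polynomial.X ^ (p ^ d)) = 0), mul_zero, add_zero]
    have hL : ((Multiset.map x Finset.univ.val).map
        (fun a => 1 + Polynomial.C a * Polynomial.X)).prod =
        ∏ u : Kˣ, (1 + Polynomial.C (u : K) * Polynomial.X) ^
          (Finset.univ.filter (fun i => x i = u)).card := by
      rw [Multiset.map_map]
      change ∏ i, (1 + Polynomial.C (x i) * Polynomial.X) = _
      simp_rw [← Finset.prod_const, Finset.prod_filter]
      rw [Finset.prod_comm]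
      refine Finset.prod_congr rfl fun i _ => ?_
      by_cases h0 : x i = 0
      · rw [Finset.prod_eq_one]
        · simp [h0]
        · intro u _
          rw [if_neg]
          rw [h0]
          exact u.ne_zero.symm
      · rw [Finset.prod_eq_single (Units.mk0 _ h0)]
        · simp
        · intro u _ hu
          rw [if_neg]
          intro h'
          exact hu (Units.ext h'.symm)
        · simp
    have hR : ((Mb b).map (fun a => 1 + Polynomial.C a * Polynomial.X)).prod =
        ∏ u : Kˣ, (1 + Polynomial.C (u : K) * Polynomial.X) ^ (b u : ℕ) := by
      unfold Mb
      rw [← Multiset.coe_mapAddMonoidHom, map_sum, Multiset.prod_sum]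
      simp
    rw [hL, hR, map_prod, map_prod]
    refine Finset.prod_congr rfl fun u _ => ?_
    rw [map_pow, map_pow]
    exact pow_eq_pow_of_modEq (h u) (hone u)
  have := (Polynomial.X_pow_dvd_iff.1 hdvd) k hk
  rwa [Polynomial.coeff_sub, sub_eq_zero] at this

/-- Asymptotic behavior of the value distribution of linear combinations
`∑ c_t e_{k_t}` of elementary symmetric polynomials over `𝔽_q`, where
`0 < k_1 < ⋯ < k_s`, `k_s > 1`, and `D = p^(⌊log_p k_s⌋ + 1)`. -/
theorem tendsto_prob_linear_comb_esymm (p r : ℕ) (hp : p.Prime) (hr : 1 ≤ r)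
    (K : Type*) [Field K] [Fintype K] [DecidableEq K] (hK : Fintype.card K = p ^ r)
    (L : K →+ K) (s : ℕ) (ks : Fin (s + 1) → ℕ) (hmono : StrictMono ks)
    (h0 : 0 < ks 0) (hlast : 1 < ks (Fin.last s)) (c : Fin (s + 1) → K) (γ : K) :
    Tendsto
      (fun n : ℕ =>
        ((Finset.univ.filter (fun x : Fin n → K =>
            L (∑ t, c t * evalE (ks t) x) = γ)).card : ℝ) / ((p : ℝ) ^ r) ^ n)
      atTop
      (𝓝 (((Finset.univ.filter
          (fun b : Kˣ → Fin (p ^ (Nat.log p (ks (Fin.last s)) + 1)) =>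
            L (∑ t, c t * (Mb b).esymm (ks t)) = γ)).card : ℝ) /
        ((p : ℝ) ^ (Nat.log p (ks (Fin.last s)) + 1)) ^ (p ^ r - 1))) := by
  have hfp : Fact p.Prime := ⟨hp⟩
  have hchar : CharP K p := by
    obtain ⟨p', hp'⟩ := CharP.exists K
    obtain ⟨m, hprime, hm⟩ := FiniteField.card K p'
    have : p' = p := by
      have h1 : p' ∣ p ^ r := by
        rw [← hK, hm]
        exact dvd_pow_self _ m.ne_zero
      exact (Nat.prime_dvd_prime_iff_eq hprime hp).1 (hprime.dvd_of_dvd_pow h1)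
    exact this ▸ hp'
  have hks : ∀ t, ks t < p ^ (Nat.log p (ks (Fin.last s)) + 1) := fun t =>
    (hmono.monotone (Fin.le_last t)).trans_lt (Nat.lt_pow_succ_log_self hp.one_lt _)
  generalize Nat.log p (ks (Fin.last s)) + 1 = d at hks ⊢
  have hD : NeZero (p ^ d) := ⟨pow_ne_zero _ hp.ne_zero⟩
  let e : K → (Kˣ → ZMod (p ^ d)) := fun a u => if a = u then 1 else 0
  have hS : ∀ (n : ℕ) (x : Fin n → K) (b : Kˣ → Fin (p ^ d)),
      (∑ i, e (x i) = fun u => ((b u : ℕ) : ZMod (p ^ d))) ↔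
      ∀ u : Kˣ, (Finset.univ.filter (fun i => x i = u)).card ≡ b u [MOD p ^ d] := by
    intro n x b
    rw [funext_iff]
    refine forall_congr' fun u => ?_
    rw [← ZMod.natCast_eq_natCast_iff]
    simp [e, Finset.sum_apply]
  have hgen : ∀ ψ : AddChar (Kˣ → ZMod (p ^ d)) ℂ, (∀ a, ψ (e a) = 1) → ψ = 0 := by
    intro ψ hψ
    ext g
    have hg : g = ∑ u : Kˣ, (g u).val • e (u : K) := by
      ext v
      rw [Finset.sum_apply, Finset.sum_eq_single v]
      · rw [Pi.smul_apply, nsmul_eq_mul, ZMod.natCast_zmod_val]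
        simp [e]
      · intro u _ hu
        have : (u : K) ≠ v := fun h => hu (Units.ext h)
        simp [e, this]
      · simp
    rw [hg, aux_map_sum]
    simp only [AddChar.map_nsmul_eq_pow, hψ, one_pow, Finset.prod_const_one]
    rfl
  have hlim := fun g => aux_limit e 0 (by ext u; simp [e, u.ne_zero.symm]) hgen g
  have hcard : ∀ n : ℕ, ((Finset.univ.filter (fun x : Fin n → K =>
            L (∑ t, c t * evalE (ks t) x) = γ)).card : ℝ) =
      ∑ b ∈ Finset.univ.filter (fun b : Kˣ → Fin (p ^ d) =>
            L (∑ t, c t * (Mb b).esymm (ks t)) = γ),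
        ((Finset.univ.filter (fun x : Fin n → K =>
          ∑ i, e (x i) = fun u => ((b u : ℕ) : ZMod (p ^ d)))).card : ℝ) := by
    intro n
    let β : (Fin n → K) → (Kˣ → Fin (p ^ d)) := fun x u =>
      ⟨(Finset.univ.filter (fun i => x i = u)).card % p ^ d, Nat.mod_lt _ (NeZero.pos _)⟩
    have hβ : ∀ x b, (∑ i, e (x i) = fun u => ((b u : ℕ) : ZMod (p ^ d))) ↔ β x = b := by
      intro x b
      rw [hS, funext_iff]
      refine forall_congr' fun u => ?_
      rw [Fin.ext_iff, Nat.ModEq, Nat.mod_eq_of_lt (b u).2]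
    have hE : ∀ x t, evalE (ks t) x = (Mb (β x)).esymm (ks t) := fun x t =>
      aux_esymm p d x (β x) ((hS n x _).1 ((hβ x _).2 rfl)) _ (hks t)
    simp_rw [hβ, hE]
    rw [Finset.card_eq_sum_card_fiberwise (f := β) (t := Finset.univ.filter
      (fun b : Kˣ → Fin (p ^ d) => L (∑ t, c t * (Mb b).esymm (ks t)) = γ))]
    · push_cast
      refine Finset.sum_congr rfl fun b hb => ?_
      congr 2
      ext x
      simp only [Finset.mem_filter, Finset.mem_univ, true_and] at hb ⊢
      constructor
      · exact fun h => h.2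
      · rintro rfl
        exact ⟨hb, rfl⟩
    · intro x hx
      simpa using hx
  simp_rw [hcard, Finset.sum_div]
  have hfin := tendsto_finsetSum (Finset.univ.filter (fun b : Kˣ → Fin (p ^ d) =>
            L (∑ t, c t * (Mb b).esymm (ks t)) = γ))
    (fun b _ => hlim (fun u => ((b u : ℕ) : ZMod (p ^ d))))
  rw [Finset.sum_const, nsmul_eq_mul, mul_one_div] at hfin
  convert hfin using 3
  · simp [hK]
  · simp [Fintype.card_units, hK]
end

section
/- Let p be a prime, let k > 1 and j ≥ 1 be integers, and let F : 𝔽_p^j → 𝔽_p be any function. Then the following are equivalent: (i) for every t ∈ 𝔽_p, the real sequence (1/p^n) · #{x ∈ 𝔽_p^n : e_k(x) + F(x_1,…,x_j) = t} (defined for n ≥ j) converges to 1/p as n → ∞; (ii) either for every t ∈ 𝔽_p the real sequence (1/p^n) · #{x ∈ 𝔽_p^n : e_k(x) = t} converges to 1/p as n → ∞, or F is balanced (i.e. #{β ∈ 𝔽_p^j : F(β) = t} = p^{j−1} for every t ∈ 𝔽_p). -/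
open Filter Topology

lemma evalE_eq_coeff {K : Type*} [CommRing K] {n : ℕ} (k : ℕ) (x : Fin n → K) :
    evalE k x = (∏ i, (1 + Polynomial.C (x i) * Polynomial.X)).coeff k := by
  rw [evalE, Finset.esymm_map_val, Finset.prod_one_add, Polynomial.finsetSum_coeff,
    Finset.powersetCard_eq_filter, Finset.sum_filter]
  refine Finset.sum_congr rfl fun t _ => ?_
  rw [Finset.prod_mul_distrib, Finset.prod_const, ← map_prod, Polynomial.coeff_C_mul_X_pow]
  simp only [eq_comm]

lemma norm_sum_lt_card {X : Type*} [Fintype X] [DecidableEq X] (f : X → ℂ) (hf : ∀ x, ‖f x‖ = 1)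
    (a b : X) (hab : f a ≠ f b) : ‖∑ x, f x‖ < Fintype.card X := by
  have hne : a ≠ b := fun h => hab (h ▸ rfl)
  have h1 : ∑ x, f x = (f a + f b) + ∑ x ∈ (Finset.univ.erase a).erase b, f x := by
    rw [add_assoc, Finset.add_sum_erase _ _ (by simp [hne.symm]), Finset.add_sum_erase _ _ (by simp)]
  have h2 : ‖f a + f b‖ < ‖f a‖ + ‖f b‖ := by
    apply norm_add_lt_of_not_sameRay
    rw [not_sameRay_iff_of_norm_eq (by rw [hf, hf])]
    exact hab
  have h3 : ∑ x, ‖f x‖ = (‖f a‖ + ‖f b‖) + ∑ x ∈ (Finset.univ.erase a).erase b, ‖f x‖ := by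
    rw [add_assoc, Finset.add_sum_erase _ (fun x => ‖f x‖) (by simp [hne.symm]),
      Finset.add_sum_erase _ (fun x => ‖f x‖) (by simp)]
  have h4 : ∑ x, ‖f x‖ = Fintype.card X := by simp [hf]
  have h5 := norm_sum_le ((Finset.univ.erase a).erase b) f
  rw [h1, ← h4, h3]
  exact (norm_add_le _ _).trans_lt (by linarith)

lemma addChar_map_sum {G ι : Type*} [AddCommGroup G] (χ : AddChar G ℂ) (S : Finset ι) (f : ι → G) :
    χ (∑ i ∈ S, f i) = ∏ i ∈ S, χ (f i) := by
  classical
  induction S using Finset.induction_on with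
  | empty => simp
  | insert a S ha ih => rw [Finset.sum_insert ha, Finset.prod_insert ha, AddChar.map_add_eq_mul, ih]

lemma equidist {G X : Type*} [AddCommGroup G] [Fintype G] [DecidableEq G] [Fintype X]
    [DecidableEq X] (s : X → G) (x0 : X) (h0 : s x0 = 0)
    (hs : AddSubgroup.closure (Set.range s) = ⊤) (g : G) :
    Tendsto (fun n : ℕ => ((Finset.univ.filter (fun y : Fin n → X => ∑ i, s (y i) = g)).card : ℝ)
      / (Fintype.card X : ℝ) ^ n) atTop (𝓝 (1 / (Fintype.card G : ℝ))) := by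
  classical
  have hX : (Fintype.card X : ℂ) ≠ 0 := by
    have : Nonempty X := ⟨x0⟩
    exact_mod_cast Fintype.card_ne_zero
  have hG : (Fintype.card G : ℂ) ≠ 0 := by exact_mod_cast Fintype.card_ne_zero
  have key : ∀ n : ℕ, ((Finset.univ.filter (fun y : Fin n → X => ∑ i, s (y i) = g)).card : ℂ)
      / (Fintype.card X : ℂ) ^ n = (1 / (Fintype.card G : ℂ)) *
        ∑ χ : AddChar G ℂ, χ (-g) * ((∑ x, χ (s x)) / (Fintype.card X : ℂ)) ^ n := by
    intro n
    have e1 : ((Finset.univ.filter (fun y : Fin n → X => ∑ i, s (y i) = g)).card : ℂ) *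
        Fintype.card G = ∑ χ : AddChar G ℂ, χ (-g) * (∑ x, χ (s x)) ^ n := by
      have : ∀ χ : AddChar G ℂ, χ (-g) * (∑ x, χ (s x)) ^ n
          = ∑ y : Fin n → X, χ (∑ i, s (y i) - g) := by
        intro χ
        rw [Finset.sum_pow', Finset.mul_sum]
        simp only [Fintype.piFinset_univ]
        refine Finset.sum_congr rfl fun y _ => ?_
        rw [sub_eq_add_neg, AddChar.map_add_eq_mul, addChar_map_sum, mul_comm]
      simp_rw [this]
      rw [Finset.sum_comm]
      simp_rw [AddChar.sum_apply_eq_ite, sub_eq_zero]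
      rw [← Finset.sum_filter, Finset.sum_const, nsmul_eq_mul]
    simp_rw [div_pow, ← mul_div_assoc]
    rw [← Finset.sum_div, ← e1]
    field_simp
  have lim : Tendsto (fun n : ℕ => (1 / (Fintype.card G : ℂ)) *
        ∑ χ : AddChar G ℂ, χ (-g) * ((∑ x, χ (s x)) / (Fintype.card X : ℂ)) ^ n) atTop
        (𝓝 ((1 / (Fintype.card G : ℂ)) * ∑ χ : AddChar G ℂ, if χ = 0 then 1 else 0)) := by
    refine Tendsto.const_mul _ (tendsto_finsetSum _ fun χ _ => ?_)
    split_ifs with h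
    · subst h
      simp [hX]
    · have hx : ∃ x1, χ (s x1) ≠ 1 := by
        by_contra! hcon
        apply h
        rw [AddChar.eq_zero_iff]
        intro z
        have hz : z ∈ AddSubgroup.closure (Set.range s) := hs ▸ AddSubgroup.mem_top z
        induction hz using AddSubgroup.closure_induction with
        | mem x hx => obtain ⟨y, rfl⟩ := hx; exact hcon y
        | zero => simp
        | add x y _ _ h1 h2 => rw [AddChar.map_add_eq_mul, h1, h2, one_mul]
        | neg x _ h1 => rw [AddChar.map_neg_eq_inv, h1, inv_one]
      obtain ⟨x1, hx1⟩ := hx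
      have hlt := norm_sum_lt_card (fun x => χ (s x)) (fun x => AddChar.norm_apply _ _) x1 x0
        (by simpa [h0] using hx1)
      have : Tendsto (fun n : ℕ => ((∑ x, χ (s x)) / (Fintype.card X : ℂ)) ^ n) atTop (𝓝 0) := by
        apply tendsto_pow_atTop_nhds_zero_of_norm_lt_one
        rw [norm_div, Complex.norm_natCast, div_lt_one (lt_of_le_of_lt (norm_nonneg _) hlt)]
        exact hlt
      simpa using this.const_mul (χ (-g))
  simp only [← key, Finset.sum_ite_eq', Finset.mem_univ, if_true, mul_one] at lim
  have := (Complex.continuous_re.tendsto _).comp lim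
  refine (this.congr fun n => ?_).trans_eq ?_
  · simp only [Function.comp]
    rw [← Complex.ofReal_re (_ / _)]
    push_cast
    rfl
  · congr 1
    rw [← Complex.ofReal_re (_ / _)]
    push_cast
    rfl

lemma const_of_zero (p : ℕ) [Fact p.Prime] (ζ : ℂ) (hζ : IsPrimitiveRoot ζ p) (f : ZMod p → ℕ)
    (h : ∑ a, (f a : ℂ) * ζ ^ a.val = 0) : ∀ a, f a = f 0 := by
  have hp : p.Prime := Fact.out
  set A : Polynomial ℚ := ∑ a : ZMod p, Polynomial.C (f a : ℚ) * Polynomial.X ^ a.val with hA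
  have hA0 : Polynomial.aeval ζ A = 0 := by
    simpa [hA] using h
  have hdvd : Polynomial.cyclotomic p ℚ ∣ A := by
    rw [Polynomial.cyclotomic_eq_minpoly_rat hζ hp.pos]
    exact minpoly.dvd ℚ ζ hA0
  have hcoeff : ∀ a : ZMod p, A.coeff a.val = f a := by
    intro a
    simp only [hA, Polynomial.finsetSum_coeff, Polynomial.coeff_C_mul_X_pow]
    rw [Finset.sum_eq_single a]
    · simp
    · intro b _ hb
      rw [if_neg]
      intro h
      exact hb (ZMod.val_injective p h).symm
    · simp
  have hdeg : A.natDegree ≤ p - 1 := by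
    apply Polynomial.natDegree_sum_le_of_forall_le
    intro a _
    refine (Polynomial.natDegree_C_mul_X_pow_le _ _).trans ?_
    have := ZMod.val_lt a
    omega
  obtain ⟨q, hq⟩ := hdvd
  have hqdeg : q.natDegree = 0 := by
    by_cases hq0 : q = 0
    · simp [hq0]
    · rw [hq, Polynomial.natDegree_mul (Polynomial.cyclotomic_ne_zero _ _) hq0,
        Polynomial.natDegree_cyclotomic, Nat.totient_prime hp] at hdeg
      omega
  rw [Polynomial.eq_C_of_natDegree_eq_zero hqdeg] at hq
  have hc : ∀ a : ZMod p, A.coeff a.val = q.coeff 0 := by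
    intro a
    rw [hq, Polynomial.coeff_mul_C, Polynomial.cyclotomic_prime, Polynomial.finsetSum_coeff]
    simp [Polynomial.coeff_X_pow, ZMod.val_lt]
  intro a
  have := (hcoeff a).symm.trans ((hc a).trans ((hc 0).symm.trans (hcoeff 0)))
  exact_mod_cast this

lemma const_or_const (p : ℕ) [Fact p.Prime] (A B : ZMod p → ℕ) (c : ℕ)
    (h : ∀ t, ∑ a, A (t - a) * B a = c) : (∀ a, A a = A 0) ∨ (∀ a, B a = B 0) := by
  have hp : p.Prime := Fact.out
  obtain ⟨ζ, hζ⟩ : ∃ ζ : ℂ, IsPrimitiveRoot ζ p := ⟨_, Complex.isPrimitiveRoot_exp p hp.ne_zero⟩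
  have hmul : ∀ a b : ZMod p, ζ ^ (a + b).val = ζ ^ a.val * ζ ^ b.val := by
    intro a b
    rw [ZMod.val_add, ← pow_add, ← pow_mod_orderOf ζ (a.val + b.val), ← hζ.eq_orderOf]
  have hsum : ∑ a : ZMod p, ζ ^ a.val = 0 := by
    have h1 := hζ.geom_sum_eq_zero hp.one_lt
    have h2 : ζ * ∑ a : ZMod p, ζ ^ a.val = ∑ a : ZMod p, ζ ^ a.val := by
      have : Fact (1 < p) := ⟨hp.one_lt⟩
      rw [Finset.mul_sum, ← Equiv.sum_comp (Equiv.addLeft (1 : ZMod p)) (fun a => ζ ^ a.val)]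
      simp only [Equiv.coe_addLeft, hmul, ZMod.val_one, pow_one]
    have h3 : (ζ - 1) * ∑ a : ZMod p, ζ ^ a.val = 0 := by linear_combination h2
    exact (mul_eq_zero.1 h3).resolve_left (sub_ne_zero.2 (hζ.ne_one hp.one_lt))
  have hprod : (∑ a, (A a : ℂ) * ζ ^ a.val) * (∑ a, (B a : ℂ) * ζ ^ a.val) = 0 := by
    calc _ = ∑ b, ∑ a, ((A a : ℂ) * ζ ^ a.val) * ((B b : ℂ) * ζ ^ b.val) := by
            rw [Finset.sum_mul_sum, Finset.sum_comm]
      _ = ∑ b, ∑ t : ZMod p, ((A (t - b) : ℂ) * B b) * ζ ^ t.val := by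
            refine Finset.sum_congr rfl fun b _ => ?_
            rw [← Equiv.sum_comp (Equiv.addRight b) (fun t => ((A (t - b) : ℂ) * B b) * ζ ^ t.val)]
            refine Finset.sum_congr rfl fun a _ => ?_
            simp only [Equiv.coe_addRight, hmul, add_sub_cancel_right]
            ring
      _ = ∑ t : ZMod p, (c : ℂ) * ζ ^ t.val := by
            rw [Finset.sum_comm]
            refine Finset.sum_congr rfl fun t _ => ?_
            rw [← Finset.sum_mul, ← h t]
            push_cast
            rfl
      _ = 0 := by rw [← Finset.mul_sum, hsum, mul_zero]
  rcases mul_eq_zero.1 hprod with h | h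
  · exact Or.inl (const_of_zero p ζ hζ A h)
  · exact Or.inr (const_of_zero p ζ hζ B h)

lemma exists_group (p : ℕ) [Fact p.Prime] (k : ℕ) :
    ∃ (G : Type) (_ : AddCommGroup G) (_ : Fintype G) (s : ZMod p → G) (f : G → ZMod p),
      s 0 = 0 ∧ AddSubgroup.closure (Set.range s) = ⊤ ∧
      ∀ (n : ℕ) (y : Fin n → ZMod p), evalE k y = f (∑ i, s (y i)) := by
  classical
  let m : Polynomial (ZMod p) := Polynomial.X ^ (k + 1)
  have hm : m.Monic := Polynomial.monic_X_pow _
  let R := AdjoinRoot m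
  have : Module.Finite (ZMod p) R := hm.finite_adjoinRoot
  have : Finite R := Module.finite_of_finite (ZMod p)
  have hnil : ∀ x : ZMod p, IsNilpotent (AdjoinRoot.mk m (Polynomial.C x * Polynomial.X)) := by
    intro x
    refine ⟨k + 1, ?_⟩
    rw [← map_pow, AdjoinRoot.mk_eq_zero, mul_pow]
    exact dvd_mul_left _ _
  let u : ZMod p → Rˣ := fun x => (hnil x).isUnit_one_add.unit
  have hu : ∀ x, ((u x : Rˣ) : R) = AdjoinRoot.mk m (1 + Polynomial.C x * Polynomial.X) := by
    intro x
    simp [u]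
  let v : ZMod p → Additive Rˣ := fun x => Additive.ofMul (u x)
  let H := AddSubgroup.closure (Set.range v)
  let c : R → ZMod p := fun r => (Function.surjInv AdjoinRoot.mk_surjective r).coeff k
  have hc : ∀ q, c (AdjoinRoot.mk m q) = q.coeff k := by
    intro q
    have h1 := Function.surjInv_eq (AdjoinRoot.mk_surjective (g := m)) (AdjoinRoot.mk m q)
    rw [AdjoinRoot.mk_eq_mk, Polynomial.X_pow_dvd_iff] at h1
    have h2 := h1 k (Nat.lt_succ_self k)
    rw [Polynomial.coeff_sub, sub_eq_zero] at h2
    exact h2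
  let s : ZMod p → H := fun x => ⟨v x, AddSubgroup.subset_closure ⟨x, rfl⟩⟩
  refine ⟨H, inferInstance, Fintype.ofFinite _, s, fun h => c ((Additive.toMul (h : Additive Rˣ) : Rˣ) : R),
    ?_, ?_, ?_⟩
  · apply Subtype.ext
    apply Additive.toMul.injective
    apply Units.ext
    change ((u 0 : Rˣ) : R) = 1
    rw [hu]
    simp
  · rw [← AddSubgroup.closure_closure_coe_preimage (k := Set.range v)]
    congr 1
    ext ⟨h, hh⟩
    simp [s, H, Subtype.ext_iff]
  · intro n y
    have : (((Additive.toMul ((∑ i, s (y i) : H) : Additive Rˣ)) : Rˣ) : R)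
        = AdjoinRoot.mk m (∏ i, (1 + Polynomial.C (y i) * Polynomial.X)) := by
      rw [AddSubgroup.val_finsetSum, toMul_sum, Units.coe_prod, map_prod]
      exact Finset.prod_congr rfl fun i _ => hu (y i)
    simp only [this, hc]
    exact evalE_eq_coeff k y

lemma tendsto_count {G X : Type*} [AddCommGroup G] [Fintype G] [DecidableEq G] [Fintype X]
    [DecidableEq X] (s : X → G) (x0 : X) (h0 : s x0 = 0)
    (hs : AddSubgroup.closure (Set.range s) = ⊤) {K : Type*} [DecidableEq K] (f : G → K)
    (g0 : G) (t : K) :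
    Tendsto (fun n : ℕ => ((Finset.univ.filter
        (fun y : Fin n → X => f (g0 + ∑ i, s (y i)) = t)).card : ℝ)
      / (Fintype.card X : ℝ) ^ n) atTop
      (𝓝 (((Finset.univ.filter (fun g => f g = t)).card : ℝ) / (Fintype.card G : ℝ))) := by
  have h1 : Tendsto (fun n : ℕ => ∑ g ∈ Finset.univ.filter (fun g => f g = t),
      ((Finset.univ.filter (fun y : Fin n → X => ∑ i, s (y i) = g - g0)).card : ℝ)
      / (Fintype.card X : ℝ) ^ n) atTop
      (𝓝 (∑ g ∈ Finset.univ.filter (fun g => f g = t), 1 / (Fintype.card G : ℝ))) :=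
    tendsto_finsetSum _ fun g _ => equidist s x0 h0 hs (g - g0)
  rw [Finset.sum_const, nsmul_eq_mul, mul_one_div] at h1
  refine h1.congr fun n => ?_
  rw [← Finset.sum_div]
  congr 1
  rw [Finset.card_eq_sum_card_fiberwise (f := fun y => g0 + ∑ i, s (y i))
    (t := Finset.univ.filter (fun g => f g = t)) (by intro y hy; simpa using hy)]
  push_cast
  refine Finset.sum_congr rfl fun g hg => ?_
  congr 2
  ext y
  simp only [Finset.mem_filter, Finset.mem_univ, true_and] at hg ⊢
  constructor
  · intro h
    have : g0 + ∑ i, s (y i) = g := by rw [h]; abel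
    exact ⟨by rw [this, hg], this⟩
  · rintro ⟨_, h⟩
    rw [← h]; abel

lemma card_split (p : ℕ) [Fact p.Prime] {G : Type*} [AddCommGroup G] (s : ZMod p → G)
    (f : G → ZMod p) (k : ℕ)
    (hf : ∀ (n : ℕ) (y : Fin n → ZMod p), evalE k y = f (∑ i, s (y i)))
    (j n : ℕ) (F : (Fin j → ZMod p) → ZMod p) (t : ZMod p) :
    (Finset.univ.filter (fun x : Fin (j + n) → ZMod p =>
              evalE k x + F (fun i => x (Fin.castAdd n i)) = t)).card =
    ∑ β : Fin j → ZMod p, (Finset.univ.filter (fun y : Fin n → ZMod p =>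
      f (∑ i, s (β i) + ∑ i, s (y i)) = t - F β)).card := by
  simp only [Finset.card_filter]
  rw [← Equiv.sum_comp (Fin.appendEquiv j n), Fintype.sum_prod_type]
  refine Finset.sum_congr rfl fun β _ => Finset.sum_congr rfl fun y _ => ?_
  simp [hf, Fin.appendEquiv, Fin.sum_univ_add, eq_sub_iff_add_eq]

/-- **Proposition 3.2.** Over the prime field `𝔽_p`, the perturbation
`e_{n,k} + F` is asymptotically balanced if and only if `e_{n,k}` is asymptotically balanced
or `F` is balanced. -/
theorem asympBalanced_perturbation_iff (p : ℕ) [Fact p.Prime]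
    (k : ℕ) (hk : 1 < k) (j : ℕ) (hj : 1 ≤ j)
    (F : (Fin j → ZMod p) → ZMod p) :
    (∀ t : ZMod p,
      Tendsto
        (fun n : ℕ =>
          ((Finset.univ.filter (fun x : Fin (j + n) → ZMod p =>
              evalE k x + F (fun i => x (Fin.castAdd n i)) = t)).card : ℝ) / (p : ℝ) ^ (j + n))
        atTop (𝓝 (1 / (p : ℝ)))) ↔
    ((∀ t : ZMod p,
        Tendsto
          (fun n : ℕ =>
            ((Finset.univ.filter (fun x : Fin n → ZMod p => evalE k x = t)).card : ℝ) /
              (p : ℝ) ^ n)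
          atTop (𝓝 (1 / (p : ℝ)))) ∨
      (∀ t : ZMod p,
        (Finset.univ.filter (fun β : Fin j → ZMod p => F β = t)).card = p ^ (j - 1))) := by
  classical
  have hp : p.Prime := Fact.out
  obtain ⟨G, _, _, s, f, h0, hs, hf⟩ := exists_group p k
  set A : ZMod p → ℕ := fun t => (Finset.univ.filter (fun g => f g = t)).card with hA
  set B : ZMod p → ℕ := fun t => (Finset.univ.filter (fun β => F β = t)).card with hB
  have hp0 : (p : ℝ) ≠ 0 := by exact_mod_cast hp.ne_zero
  have hG0 : (Fintype.card G : ℝ) ≠ 0 := by exact_mod_cast Fintype.card_ne_zero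
  have hAsum : ∑ a, A a = Fintype.card G := by
    rw [← Finset.card_univ (α := G)]
    exact (Finset.card_eq_sum_card_fiberwise (f := f) (t := Finset.univ) (by simp)).symm
  have hpj : p ^ j = p * p ^ (j - 1) := by
    rw [← pow_succ']; congr 1; omega
  have hBsum : ∑ a, B a = p ^ j := by
    have : Fintype.card (Fin j → ZMod p) = p ^ j := by simp
    rw [← this, ← Finset.card_univ (α := Fin j → ZMod p)]
    exact (Finset.card_eq_sum_card_fiberwise (f := F) (t := Finset.univ) (by simp)).symm
  have L1 : ∀ t : ZMod p, Tendsto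
          (fun n : ℕ =>
            ((Finset.univ.filter (fun x : Fin n → ZMod p => evalE k x = t)).card : ℝ) /
              (p : ℝ) ^ n)
          atTop (𝓝 ((A t : ℝ) / Fintype.card G)) := by
    intro t
    have := tendsto_count s 0 h0 hs f 0 t
    simpa only [zero_add, ← hf, ZMod.card] using this
  have L2 : ∀ t : ZMod p, Tendsto
        (fun n : ℕ =>
          ((Finset.univ.filter (fun x : Fin (j + n) → ZMod p =>
              evalE k x + F (fun i => x (Fin.castAdd n i)) = t)).card : ℝ) / (p : ℝ) ^ (j + n))
        atTop (𝓝 (((∑ a, A (t - a) * B a : ℕ) : ℝ) / Fintype.card G / (p : ℝ) ^ j)) := by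
    intro t
    have h1 : Tendsto (fun n : ℕ => (∑ β : Fin j → ZMod p, ((Finset.univ.filter
        (fun y : Fin n → ZMod p => f (∑ i, s (β i) + ∑ i, s (y i)) = t - F β)).card : ℝ)
        / (p : ℝ) ^ n) / (p : ℝ) ^ j) atTop
        (𝓝 ((∑ β, (A (t - F β) : ℝ) / Fintype.card G) / (p : ℝ) ^ j)) := by
      refine Tendsto.div_const (tendsto_finsetSum _ fun β _ => ?_) _
      have := tendsto_count s 0 h0 hs f (∑ i, s (β i)) (t - F β)
      simpa only [ZMod.card] using this
    have h2 : ∑ β, A (t - F β) = ∑ a, A (t - a) * B a := by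
      rw [← Finset.sum_fiberwise Finset.univ F]
      refine Finset.sum_congr rfl fun a _ => ?_
      rw [Finset.sum_congr rfl (g := fun _ => A (t - a)) (by
        intro β hβ; rw [(Finset.mem_filter.1 hβ).2]), Finset.sum_const, smul_eq_mul, mul_comm]
    rw [← h2]
    push_cast
    rw [Finset.sum_div]
    refine h1.congr fun n => ?_
    rw [card_split p s f k hf, ← Finset.sum_div, div_div, ← pow_add, add_comm n j]
    push_cast
    rfl
  have E1 : (∀ t : ZMod p, Tendsto
          (fun n : ℕ =>
            ((Finset.univ.filter (fun x : Fin n → ZMod p => evalE k x = t)).card : ℝ) /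
              (p : ℝ) ^ n)
          atTop (𝓝 (1 / (p : ℝ)))) ↔ ∀ t, A t * p = Fintype.card G := by
    refine forall_congr' fun t => ?_
    have : (A t * p = Fintype.card G) ↔ (A t : ℝ) / Fintype.card G = 1 / p := by
      rw [div_eq_div_iff hG0 hp0, one_mul]
      norm_cast
    rw [this]
    exact ⟨fun h => tendsto_nhds_unique (L1 t) h, fun h => h ▸ L1 t⟩
  have E2 : (∀ t : ZMod p, Tendsto
        (fun n : ℕ =>
          ((Finset.univ.filter (fun x : Fin (j + n) → ZMod p =>
              evalE k x + F (fun i => x (Fin.castAdd n i)) = t)).card : ℝ) / (p : ℝ) ^ (j + n))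
        atTop (𝓝 (1 / (p : ℝ)))) ↔
        ∀ t, ∑ a, A (t - a) * B a = Fintype.card G * p ^ (j - 1) := by
    refine forall_congr' fun t => ?_
    have : (∑ a, A (t - a) * B a = Fintype.card G * p ^ (j - 1)) ↔
        ((∑ a, A (t - a) * B a : ℕ) : ℝ) / Fintype.card G / (p : ℝ) ^ j = 1 / p := by
      rw [div_div, div_eq_div_iff (mul_ne_zero hG0 (pow_ne_zero _ hp0)) hp0, one_mul]
      norm_cast
      rw [hpj, mul_left_comm, mul_comm _ p]
      exact (Nat.mul_right_inj hp.ne_zero).symm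
    rw [this]
    exact ⟨fun h => tendsto_nhds_unique (L2 t) h, fun h => h ▸ L2 t⟩
  rw [E1, E2]
  constructor
  · intro h
    rcases const_or_const p A B _ h with h | h
    · left
      intro t
      rw [← hAsum, Finset.sum_congr rfl (g := fun _ => A t) (fun a _ => by rw [h a, h t])]
      simp [mul_comm]
    · right
      intro t
      have h3 := hBsum
      rw [Finset.sum_congr rfl (g := fun _ => B t) (fun a _ => by rw [h a, h t])] at h3
      rw [hpj] at h3
      simp only [Finset.sum_const, Finset.card_univ, ZMod.card, smul_eq_mul] at h3
      exact Nat.eq_of_mul_eq_mul_left hp.pos h3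
  · rintro (h | h) t
    · apply Nat.eq_of_mul_eq_mul_right hp.pos
      rw [Finset.sum_mul, Finset.sum_congr rfl (g := fun a => Fintype.card G * B a)
        (fun a _ => by rw [mul_right_comm, h]), ← Finset.mul_sum, hBsum, hpj]
      ring
    · have h' : ∀ a, B a = p ^ (j - 1) := h
      simp only [h']
      have h4 : ∑ a, A (t - a) = ∑ a, A a := Equiv.sum_comp (Equiv.subLeft t) A
      rw [← Finset.sum_mul, h4, hAsum]
end

section
/- Let p be a prime, q = p^r with r ≥ 1, let k > 1 and j ≥ 1 be integers, and let F : 𝔽_q^j → 𝔽_q be any function. Suppose that either (a) for every β ∈ 𝔽_q the real sequence (1/q^n) · #{x ∈ 𝔽_q^n : e_k(x) = β} converges to 1/q as n → ∞, or (b) F is balanced (i.e. #{β ∈ 𝔽_q^j : F(β) = t} = q^{j−1} for every t ∈ 𝔽_q). Then for every γ ∈ 𝔽_q, the real sequence (1/q^n) · #{x ∈ 𝔽_q^n : e_k(x) + F(x_1,…,x_j) = γ} (defined for n ≥ j) converges to 1/q as n → ∞. -/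
open Filter Topology

open Finset in
lemma aux_identity {K : Type*} [Fintype K] (g : K → ℝ) :
    ∑ b, ∑ c, (g b - g c) ^ 2 =
      2 * (Fintype.card K : ℝ) * ∑ b, g b ^ 2 - 2 * (∑ b, g b) ^ 2 := by
  have h : ∀ b c, (g b - g c) ^ 2 = g b ^ 2 + g c ^ 2 - 2 * (g b * g c) := by
    intro b c; ring
  simp only [h, Finset.sum_sub_distrib, Finset.sum_add_distrib, Finset.sum_const,
    ← Finset.mul_sum, ← Finset.sum_mul, Finset.card_univ, nsmul_eq_mul]
  ring

/-- averaging operator -/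
noncomputable def avgOp {K X : Type*} [Fintype K] (σ : K → X ≃ X) (f : X → ℝ) : X → ℝ :=
  fun x => (∑ b, f (σ b x)) / (Fintype.card K : ℝ)

lemma avgOp_energy {K X : Type*} [Fintype K] [Nonempty K] [Fintype X] (σ : K → X ≃ X)
    (f : X → ℝ) :
    ∑ x, ∑ b, ∑ c, (f (σ b x) - f (σ c x)) ^ 2 =
      2 * (Fintype.card K : ℝ) ^ 2 * (∑ x, f x ^ 2 - ∑ x, avgOp σ f x ^ 2) := by
  have hq : (Fintype.card K : ℝ) ≠ 0 := by
    exact_mod_cast Fintype.card_ne_zero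
  have h1 : ∑ x, ∑ b, f (σ b x) ^ 2 = (Fintype.card K : ℝ) * ∑ x, f x ^ 2 := by
    rw [Finset.sum_comm]
    have : ∀ b, ∑ x, f (σ b x) ^ 2 = ∑ x, f x ^ 2 := fun b =>
      Equiv.sum_comp (σ b) (fun x => f x ^ 2)
    simp [this]
  have h2 : ∀ x, (∑ b, f (σ b x)) ^ 2 = (Fintype.card K : ℝ) ^ 2 * avgOp σ f x ^ 2 := by
    intro x
    unfold avgOp
    field_simp
  simp only [aux_identity (fun b => f (σ b _)), Finset.sum_sub_distrib, ← Finset.mul_sum, h1, h2]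
  ring

lemma avgOp_tendsto {K X : Type*} [Fintype K] [Nonempty K] [Fintype X] (σ : K → X ≃ X)
    (f : X → ℝ) (b c : K) (x : X) :
    Tendsto (fun n : ℕ => (avgOp σ)^[n] f (σ b x) - (avgOp σ)^[n] f (σ c x)) atTop (𝓝 0) := by
  set A : ℕ → ℝ := fun n => ∑ x, ((avgOp σ)^[n] f x) ^ 2 with hA
  have hE : ∀ n, ∑ x, ∑ b, ∑ c,
      ((avgOp σ)^[n] f (σ b x) - (avgOp σ)^[n] f (σ c x)) ^ 2 =
      2 * (Fintype.card K : ℝ) ^ 2 * (A n - A (n + 1)) := by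
    intro n
    rw [avgOp_energy]
    simp only [hA, Function.iterate_succ_apply']
  have hq : (0 : ℝ) < 2 * (Fintype.card K : ℝ) ^ 2 := by
    have : 0 < Fintype.card K := Fintype.card_pos
    positivity
  have hanti : Antitone A := by
    apply antitone_nat_of_succ_le
    intro n
    have : 0 ≤ 2 * (Fintype.card K : ℝ) ^ 2 * (A n - A (n + 1)) := by
      rw [← hE]; positivity
    have := nonneg_of_mul_nonneg_right this hq
    linarith
  have hbdd : BddBelow (Set.range A) := ⟨0, by rintro _ ⟨n, rfl⟩; simp only [hA]; positivity⟩
  have hlim := tendsto_atTop_ciInf hanti hbdd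
  have hd : Tendsto (fun n => 2 * (Fintype.card K : ℝ) ^ 2 * (A n - A (n + 1))) atTop (𝓝 0) := by
    have := (hlim.sub (hlim.comp (tendsto_add_atTop_nat 1))).const_mul
      (2 * (Fintype.card K : ℝ) ^ 2)
    simpa using this
  have hsq : Tendsto (fun n : ℕ =>
      ((avgOp σ)^[n] f (σ b x) - (avgOp σ)^[n] f (σ c x)) ^ 2) atTop (𝓝 0) := by
    refine squeeze_zero (fun n => sq_nonneg _) (fun n => ?_) hd
    rw [← hE]
    refine le_trans ?_ (Finset.single_le_sum (f := fun x => ∑ b, ∑ c,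
      ((avgOp σ)^[n] f (σ b x) - (avgOp σ)^[n] f (σ c x)) ^ 2)
      (fun _ _ => by positivity) (Finset.mem_univ x))
    refine le_trans ?_ (Finset.single_le_sum (f := fun b => ∑ c,
      ((avgOp σ)^[n] f (σ b x) - (avgOp σ)^[n] f (σ c x)) ^ 2)
      (fun _ _ => by positivity) (Finset.mem_univ b))
    exact Finset.single_le_sum (f := fun c =>
      ((avgOp σ)^[n] f (σ b x) - (avgOp σ)^[n] f (σ c x)) ^ 2)
      (fun _ _ => by positivity) (Finset.mem_univ c)
  have := hsq.sqrt
  simp only [Real.sqrt_sq_eq_abs, Real.sqrt_zero] at this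
  exact (tendsto_zero_iff_abs_tendsto_zero _).2 this

lemma esymm_cons_succ {K : Type*} [CommSemiring K] (b : K) (s : Multiset K) (i : ℕ) :
    (b ::ₘ s).esymm (i + 1) = s.esymm (i + 1) + b * s.esymm i := by
  simp [Multiset.esymm, Multiset.powersetCard_cons, Multiset.map_map, Function.comp_def,
    Multiset.sum_map_mul_left]

lemma esymm_zero' {K : Type*} [CommSemiring K] (s : Multiset K) : s.esymm 0 = 1 := by
  simp [Multiset.esymm]

/-- one multiplication step by `1 + b t` -/
def stepFun {K : Type*} [Field K] (k : ℕ) (b : K) (v : Fin (k + 1) → K) : Fin (k + 1) → K :=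
  Fin.cons (v 0) (fun i : Fin k => v i.succ + b * v i.castSucc)

lemma stepFun_injective {K : Type*} [Field K] (k : ℕ) (b : K) :
    Function.Injective (stepFun (K := K) k b) := by
  intro v w h
  have h0 : v 0 = w 0 := by simpa [stepFun] using congrFun h 0
  funext i
  induction i using Fin.induction with
  | zero => exact h0
  | succ i ih =>
    have := congrFun h i.succ
    simp only [stepFun, Fin.cons_succ, ih] at this
    exact add_right_cancel this

noncomputable def stepEquiv {K : Type*} [Field K] [Fintype K] (k : ℕ) (b : K) :
    (Fin (k + 1) → K) ≃ (Fin (k + 1) → K) :=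
  Equiv.ofBijective (stepFun k b) (Finite.injective_iff_bijective.1 (stepFun_injective k b))

def symVec {K : Type*} [Field K] (k : ℕ) (s : Multiset K) : Fin (k + 1) → K :=
  fun i => s.esymm i

lemma stepEquiv_symVec {K : Type*} [Field K] [Fintype K] (k : ℕ) (b : K) (s : Multiset K) :
    stepEquiv k b (symVec k s) = symVec k (b ::ₘ s) := by
  funext i
  refine Fin.cases ?_ (fun i => ?_) i
  · simp [stepEquiv, stepFun, symVec, esymm_zero']
  · simp [stepEquiv, stepFun, symVec, esymm_cons_succ]

lemma stepEquiv_zero {K : Type*} [Field K] [Fintype K] (k : ℕ) (v : Fin (k + 1) → K) :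
    stepEquiv k 0 v = v := by
  funext i
  refine Fin.cases ?_ (fun i => ?_) i
  · simp [stepEquiv, stepFun]
  · simp [stepEquiv, stepFun]

lemma iterate_symVec {K : Type*} [Field K] [Fintype K] (k : ℕ) (f : (Fin (k + 1) → K) → ℝ)
    (n : ℕ) (s : Multiset K) :
    (avgOp (stepEquiv (K := K) k))^[n] f (symVec k s) =
      (∑ y : Fin n → K, f (symVec k (s + Multiset.map y Finset.univ.val))) /
        (Fintype.card K : ℝ) ^ n := by
  induction n generalizing s with
  | zero => simp
  | succ n ih =>
    rw [Function.iterate_succ_apply', avgOp]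
    simp only [stepEquiv_symVec, ih]
    rw [← Finset.sum_div, div_div, ← pow_succ]
    congr 1
    rw [← (Fin.consEquiv (fun _ : Fin (n + 1) => K)).sum_comp, Fintype.sum_prod_type]
    refine Finset.sum_congr rfl fun b _ => Finset.sum_congr rfl fun y _ => ?_
    congr 2
    simp only [Fin.consEquiv, Equiv.coe_fn_mk, Fin.univ_val_map, List.ofFn_succ, Fin.cons_zero,
      Fin.cons_succ, ← Multiset.cons_coe, Multiset.cons_add, Multiset.add_cons]

/-- proportion of `y ∈ K^n` with `e_k (s, y) = c` -/
noncomputable def prop {K : Type*} [Field K] [Fintype K] [DecidableEq K] (k : ℕ)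
    (s : Multiset K) (c : K) (n : ℕ) : ℝ :=
  ((Finset.univ.filter (fun y : Fin n → K =>
    (s + Multiset.map y Finset.univ.val).esymm k = c)).card : ℝ) / (Fintype.card K : ℝ) ^ n

lemma prop_eq {K : Type*} [Field K] [Fintype K] [DecidableEq K] (k : ℕ)
    (s : Multiset K) (c : K) (n : ℕ) :
    prop k s c n = (avgOp (stepEquiv (K := K) k))^[n]
      (fun v => if v (Fin.last k) = c then 1 else 0) (symVec k s) := by
  rw [iterate_symVec, prop]
  simp [symVec, Finset.sum_boole]

lemma prop_tendsto {K : Type*} [Field K] [Fintype K] [DecidableEq K] (k : ℕ)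
    (s : Multiset K) (c : K) :
    Tendsto (fun n => prop k s c n - prop k 0 c n) atTop (𝓝 0) := by
  induction s using Multiset.induction with
  | empty => simp
  | cons b s ih =>
    have h := avgOp_tendsto (stepEquiv (K := K) k)
      (fun v => if v (Fin.last k) = c then 1 else 0) b 0 (symVec k s)
    simp only [stepEquiv_zero] at h
    simp only [stepEquiv_symVec, ← prop_eq] at h
    simpa using h.add ih

lemma prop_sum {K : Type*} [Field K] [Fintype K] [DecidableEq K] (k : ℕ)
    (s : Multiset K) (n : ℕ) : ∑ c, prop k s c n = 1 := by
  have hq : (Fintype.card K : ℝ) ≠ 0 := by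
    exact_mod_cast Fintype.card_ne_zero
  unfold prop
  rw [← Finset.sum_div, ← Nat.cast_sum, ← Finset.card_eq_sum_card_fiberwise (by simp)]
  simp [hq]

lemma count_eq {K : Type*} [Field K] [Fintype K] [DecidableEq K] (k j n : ℕ)
    (F : (Fin j → K) → K) (γ : K) :
    ((Finset.univ.filter (fun x : Fin (j + n) → K =>
              evalE k x + F (fun i => x (Fin.castAdd n i)) = γ)).card : ℝ) /
            (Fintype.card K : ℝ) ^ (j + n) =
    (∑ β : Fin j → K, prop k (Multiset.map β Finset.univ.val) (γ - F β) n) /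
      (Fintype.card K : ℝ) ^ j := by
  unfold prop
  rw [← Finset.sum_div, div_div, ← pow_add, add_comm n j]
  congr 1
  rw [← Finset.sum_boole, ← (Fin.appendEquiv (α := K) j n).sum_comp, Fintype.sum_prod_type]
  refine Finset.sum_congr rfl fun β _ => ?_
  rw [← Finset.sum_boole]
  refine Finset.sum_congr rfl fun y _ => ?_
  have h : Multiset.map (Fin.append β y) Finset.univ.val =
      Multiset.map β Finset.univ.val + Multiset.map y Finset.univ.val := by
    have := (finSumFinEquiv (m := j) (n := n))
    have h1 : (Finset.univ : Finset (Fin (j + n))).val =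
      (Finset.univ : Finset (Fin j ⊕ Fin n)).val.map finSumFinEquiv := by
      rw [← Finset.map_univ_equiv finSumFinEquiv]; rfl
    rw [h1, ← Finset.univ_disjSum_univ, Finset.val_disjSum, Multiset.disjSum]
    simp [Multiset.map_map, Function.comp_def]
  simp [Fin.appendEquiv, evalE, h, eq_sub_iff_add_eq]


/-- **sufficiency direction of Proposition 3.2, over any `𝔽_q`.**
If `e_{n,k}` is asymptotically balanced over `𝔽_q` or `F` is balanced, then the perturbation
`e_{n,k} + F` is asymptotically balanced over `𝔽_q`. -/
theorem asympBalanced_perturbation_of (p r : ℕ) (hp : p.Prime) (hr : 1 ≤ r)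
    (K : Type*) [Field K] [Fintype K] [DecidableEq K] (hK : Fintype.card K = p ^ r)
    (k : ℕ) (hk : 1 < k) (j : ℕ) (hj : 1 ≤ j)
    (F : (Fin j → K) → K)
    (h : (∀ β : K,
        Tendsto
          (fun n : ℕ =>
            ((Finset.univ.filter (fun x : Fin n → K => evalE k x = β)).card : ℝ) /
              ((p : ℝ) ^ r) ^ n)
          atTop (𝓝 (1 / ((p : ℝ) ^ r)))) ∨
      (∀ t : K,
        (Finset.univ.filter (fun β : Fin j → K => F β = t)).card = (p ^ r) ^ (j - 1))) :
    ∀ γ : K,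
      Tendsto
        (fun n : ℕ =>
          ((Finset.univ.filter (fun x : Fin (j + n) → K =>
              evalE k x + F (fun i => x (Fin.castAdd n i)) = γ)).card : ℝ) /
            ((p : ℝ) ^ r) ^ (j + n))
        atTop (𝓝 (1 / ((p : ℝ) ^ r))) := by
  have hqr : ((p : ℝ) ^ r) = (Fintype.card K : ℝ) := by rw [hK]; push_cast; rfl
  have hq : (Fintype.card K : ℝ) ≠ 0 := by
    exact_mod_cast Fintype.card_ne_zero
  intro γ
  rw [hqr] at h ⊢
  simp only [count_eq]
  have key : Tendsto (fun n => (∑ β : Fin j → K,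
      (prop k (Multiset.map β Finset.univ.val) (γ - F β) n - prop k 0 (γ - F β) n)) /
      (Fintype.card K : ℝ) ^ j) atTop (𝓝 0) := by
    have := (tendsto_finsetSum (Finset.univ : Finset (Fin j → K)) (fun β _ =>
      prop_tendsto k (Multiset.map β Finset.univ.val) (γ - F β))).div_const
        ((Fintype.card K : ℝ) ^ j)
    simpa using this
  have main : Tendsto (fun n => (∑ β : Fin j → K, prop k 0 (γ - F β) n) /
      (Fintype.card K : ℝ) ^ j) atTop (𝓝 (1 / (Fintype.card K : ℝ))) := by
    rcases h with h | h
    · have h' : ∀ c : K, Tendsto (prop k 0 c) atTop (𝓝 (1 / (Fintype.card K : ℝ))) := by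
        intro c
        have e : prop k 0 c = fun n : ℕ =>
            ((Finset.univ.filter (fun x : Fin n → K => evalE k x = c)).card : ℝ) /
              (Fintype.card K : ℝ) ^ n := by
          funext n
          simp [prop, evalE]
        rw [e]
        exact h c
      have := (tendsto_finsetSum (Finset.univ : Finset (Fin j → K)) (fun β _ =>
        h' (γ - F β))).div_const ((Fintype.card K : ℝ) ^ j)
      convert this using 2
      simp
    · refine tendsto_const_nhds.congr fun n => ?_
      have e : ∑ β : Fin j → K, prop k 0 (γ - F β) n = (Fintype.card K : ℝ) ^ (j - 1) := by
        rw [← Finset.sum_fiberwise (s := Finset.univ) (g := F)]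
        have : ∀ t : K, ∑ β : Fin j → K with F β = t, prop k 0 (γ - F β) n =
            (Fintype.card K : ℝ) ^ (j - 1) * prop k 0 (γ - t) n := by
          intro t
          rw [Finset.sum_congr rfl (g := fun _ => prop k 0 (γ - t) n)]
          · rw [Finset.sum_const, h t, ← hK]; simp
          · intro β hβ
            rw [(Finset.mem_filter.1 hβ).2]
        simp only [this]
        have e2 : ∑ t : K, prop k 0 (γ - t) n = 1 :=
          ((Equiv.subLeft γ).sum_comp (fun c => prop k 0 c n)).trans (prop_sum k 0 n)
        rw [← Finset.mul_sum, e2, mul_one]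
      rw [e]
      obtain ⟨i, rfl⟩ : ∃ i, j = i + 1 := ⟨j - 1, by omega⟩
      simp only [Nat.add_sub_cancel, pow_succ]
      field_simp
  have := key.add main
  simp only [zero_add, ← add_div, ← Finset.sum_add_distrib, sub_add_cancel] at this
  exact this
end

section
/- Let p be a prime, let k > 1 be an integer, D = p^{⌊log_p k⌋+1}, and for t ∈ 𝔽_p define 𝕡_k(t) = D^{−(p−1)} · #{ b : 𝔽_p^× → {0,1,…,D−1} : esymm_k(M_b) = t } ∈ ℚ. Then the p × p rational matrix A with entries A_{s,t} = 𝕡_k(s − t) for s, t ∈ 𝔽_p is singular (has determinant 0) if and only if 𝕡_k(t) = 1/p for every t ∈ 𝔽_p. -/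
open Polynomial in
/-- A non-constant rational function on `ZMod p` of total mass one gives an invertible circulant. -/
theorem circ_aux (p : ℕ) [hp : Fact p.Prime] (a : ZMod p → ℚ) (ha : ∑ t, a t = 1) :
    (Matrix.det (Matrix.of fun s t : ZMod p => a (s - t)) = 0) ↔ ∀ t, a t = 1 / (p : ℚ) := by
  have hp0 : (p : ℚ) ≠ 0 := by exact_mod_cast hp.out.ne_zero
  constructor
  · intro hdet
    by_contra hne
    set f : ℚ[X] := ∑ t : ZMod p, C (a t) * X ^ t.val with hf
    have hcoeff : ∀ t : ZMod p, f.coeff t.val = a t := by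
      intro t
      rw [hf, finset_sum_coeff, Finset.sum_eq_single t]
      · simp
      · intro b _ hb
        rw [coeff_C_mul, coeff_X_pow, if_neg, mul_zero]
        intro h
        exact hb (ZMod.val_injective p h.symm)
      · simp
    have hdeg : f.natDegree ≤ p - 1 := by
      apply natDegree_sum_le_of_forall_le
      intro t _
      refine (natDegree_C_mul_X_pow_le _ _).trans ?_
      have := ZMod.val_lt t
      omega
    have hf1 : f.eval 1 = 1 := by
      simp [hf, eval_finset_sum, ha]
    have hf0 : f ≠ 0 := by
      intro h
      simp [h] at hf1
    have hirr : Irreducible (cyclotomic p ℚ) := cyclotomic.irreducible_rat hp.out.pos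
    have h1 : IsCoprime (cyclotomic p ℚ) f := by
      rw [hirr.coprime_iff_not_dvd]
      rintro ⟨q, hq⟩
      have hq0 : q ≠ 0 := by
        rintro rfl
        simp [hf0] at hq
      have hnd : q.natDegree = 0 := by
        have h2 := natDegree_mul hirr.ne_zero hq0
        rw [← hq, natDegree_cyclotomic, Nat.totient_prime hp.out] at h2
        omega
      obtain ⟨c, rfl⟩ := natDegree_eq_zero.mp hnd
      have hac : ∀ t, a t = c := by
        intro t
        rw [← hcoeff t, hq, coeff_mul_C, cyclotomic_prime, finset_sum_coeff]
        simp [coeff_X_pow, ZMod.val_lt t]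
      apply hne
      intro t
      have h3 := ha
      simp only [hac, Finset.sum_const, Finset.card_univ, ZMod.card, nsmul_eq_mul] at h3
      rw [hac]
      field_simp
      linarith
    have h2 : IsCoprime (X - 1 : ℚ[X]) f := by
      have hX : Irreducible (X - C 1 : ℚ[X]) := irreducible_X_sub_C 1
      have : IsCoprime (X - C 1 : ℚ[X]) f := by
        rw [hX.coprime_iff_not_dvd, dvd_iff_isRoot, IsRoot, hf1]
        exact one_ne_zero
      simpa using this
    have h3 := h1.mul_left h2
    rw [cyclotomic_prime_mul_X_sub_one] at h3
    obtain ⟨u, w, huw⟩ := h3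
    let P : Matrix (ZMod p) (ZMod p) ℚ := Matrix.of fun s t => if s - t = 1 then 1 else 0
    have hP : ∀ n : ℕ, P ^ n = Matrix.of fun s t : ZMod p => if s - t = (n : ZMod p) then (1:ℚ) else 0 := by
      intro n
      induction n with
      | zero =>
        ext s t
        simp [Matrix.one_apply, sub_eq_zero]
      | succ n ih =>
        ext s t
        rw [pow_succ, ih, Matrix.mul_apply, Finset.sum_eq_single (t + 1)]
        · simp only [P, Matrix.of_apply, add_sub_cancel_left, if_true, mul_one, Nat.cast_succ]
          congr 1
          rw [sub_eq_iff_eq_add, sub_eq_iff_eq_add, add_assoc, add_comm t 1]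
        · intro b _ hb
          have : ¬ (b - t = 1) := fun h => hb (by rw [← h]; ring)
          simp [P, this]
        · simp
    have hPp : P ^ p = 1 := by
      rw [hP]
      ext s t
      simp [Matrix.one_apply, sub_eq_zero]
    have hA : aeval P f = Matrix.of fun s t : ZMod p => a (s - t) := by
      ext s t
      simp only [hf, map_sum, map_mul, aeval_C, map_pow, aeval_X, hP, Matrix.sum_apply]
      simp [Algebra.algebraMap_eq_smul_one]
    have h4 := congrArg (aeval P) huw
    simp only [map_add, map_mul, map_sub, map_pow, aeval_X, map_one, hPp, sub_self, mul_zero,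
      zero_add, hA] at h4
    have h5 := congrArg Matrix.det h4
    rw [Matrix.det_mul, hdet, mul_zero, Matrix.det_one] at h5
    exact zero_ne_one h5
  · intro h
    apply Matrix.det_zero_of_row_eq (i := (0 : ZMod p)) (j := 1) zero_ne_one
    ext t
    simp [h]

/-- **Remark of Section 3.** Writing
`𝕡_k(t) = D^(-(p-1)) ⬝ #{b : 𝔽_pˣ → {0,…,D-1} : esymm_k(M_b) = t} ∈ ℚ`, the `p × p`
circulant matrix `A` with `A s t = 𝕡_k(s - t)` is singular if and only if
`𝕡_k(t) = 1/p` for all `t ∈ 𝔽_p`. -/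
theorem det_prob_matrix_eq_zero_iff (p : ℕ) [Fact p.Prime] (k : ℕ) (hk : 1 < k) :
    (Matrix.det (Matrix.of fun s t : ZMod p =>
        ((Finset.univ.filter (fun b : (ZMod p)ˣ → Fin (p ^ (Nat.log p k + 1)) =>
            (Mb b).esymm k = s - t)).card : ℚ) /
          ((p : ℚ) ^ (Nat.log p k + 1)) ^ (p - 1)) = 0) ↔
    (∀ t : ZMod p,
      ((Finset.univ.filter (fun b : (ZMod p)ˣ → Fin (p ^ (Nat.log p k + 1)) =>
          (Mb b).esymm k = t)).card : ℚ) /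
        ((p : ℚ) ^ (Nat.log p k + 1)) ^ (p - 1) = 1 / (p : ℚ)) := by
  have hp : p.Prime := Fact.out
  have hp0 : (p : ℚ) ≠ 0 := by exact_mod_cast hp.ne_zero
  refine circ_aux p (fun t : ZMod p =>
    ((Finset.univ.filter (fun b : (ZMod p)ˣ → Fin (p ^ (Nat.log p k + 1)) =>
            (Mb b).esymm k = t)).card : ℚ) /
          ((p : ℚ) ^ (Nat.log p k + 1)) ^ (p - 1)) ?_
  rw [← Finset.sum_div, div_eq_one_iff_eq (by positivity), ← Nat.cast_sum,
    ← Finset.card_eq_sum_card_fiberwise (fun _ _ => Finset.mem_coe.2 (Finset.mem_univ _))]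
  simp [ZMod.card_units_eq_totient, Nat.totient_prime hp]
end

section
/- Let 𝔽_4 be a field with 4 elements and α ∈ 𝔽_4 with α² + α + 1 = 0, so that the elements of 𝔽_4 are 0, 1, α, α+1. Define F : 𝔽_4² → 𝔽_4 by F(x_1, x_2) = x_1³x_2³ + x_2² + x_1². Then: (i) F is not balanced (indeed #{x ∈ 𝔽_4² : F(x) = 0} = 3, #{x : F(x) = 1} = 5, #{x : F(x) = α} = 4, #{x : F(x) = α+1} = 4); (ii) it is not the case that for every β ∈ 𝔽_4 the real sequence (1/4^n) · #{x ∈ 𝔽_4^n : e_3(x) = β} converges to 1/4 as n → ∞; and yet (iii) for every γ ∈ 𝔽_4, the real sequence (1/4^n) · #{x ∈ 𝔽_4^n : e_3(x) + F(x_1, x_2) = γ} (defined for n ≥ 2) converges to 1/4 as n → ∞. -/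
open Filter Topology

namespace F4aux

section walk
variable {K S : Type*} [Fintype K] [Fintype S]

/-- Averaging operator of the walk. -/
noncomputable def T (step : S → K → S) (f : S → ℝ) (s : S) : ℝ := (∑ y, f (step s y)) / 4

variable {step : S → K → S}

lemma T_neg (f : S → ℝ) : T step (-f) = - T step f := by
  funext s; simp [T, neg_div]

lemma T_iter_neg (f : S → ℝ) (n : ℕ) : (T step)^[n] (-f) = - (T step)^[n] f := by
  induction n with
  | zero => rfl
  | succ n ih => rw [Function.iterate_succ_apply', ih, T_neg, Function.iterate_succ_apply']

lemma T_reach (hK : Fintype.card K = 4) {f : S → ℝ} {m : ℝ} (hf : ∀ s, m ≤ f s) (s : S) (y : K) :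
    (f (step s y) - m) / 4 ≤ T step f s - m := by
  have h : f (step s y) - m ≤ ∑ y, (f (step s y) - m) :=
    Finset.single_le_sum (f := fun y => f (step s y) - m)
      (fun i _ => sub_nonneg.2 (hf _)) (Finset.mem_univ y)
  rw [Finset.sum_sub_distrib] at h
  simp only [Finset.sum_const, Finset.card_univ, hK] at h
  unfold T
  norm_num at h
  linarith

lemma T_lb (hK : Fintype.card K = 4) {f : S → ℝ} {m : ℝ} (hf : ∀ s, m ≤ f s) (s : S) :
    m ≤ T step f s := by
  have : Nonempty K := Fintype.card_pos_iff.1 (by omega)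
  have y : K := Classical.arbitrary K
  have := T_reach (step := step) hK hf s y
  have := hf (step s y)
  linarith

lemma T_iter_lb (hK : Fintype.card K = 4) {f : S → ℝ} {m : ℝ} (hf : ∀ s, m ≤ f s) (n : ℕ) :
    ∀ s, m ≤ (T step)^[n] f s := by
  induction n with
  | zero => exact hf
  | succ n ih => rw [Function.iterate_succ_apply']; exact T_lb hK ih

lemma T_sum (hK : Fintype.card K = 4) (hb : ∀ y, Function.Bijective (fun s => step s y))
    (f : S → ℝ) : ∑ s, T step f s = ∑ s, f s := by
  unfold T
  rw [← Finset.sum_div, Finset.sum_comm]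
  have : ∀ y : K, ∑ s, f (step s y) = ∑ s, f s := fun y =>
    (hb y).sum_comp f
  simp [this, hK]

lemma T_iter_sum (hK : Fintype.card K = 4) (hb : ∀ y, Function.Bijective (fun s => step s y))
    (f : S → ℝ) (n : ℕ) : ∑ s, (T step)^[n] f s = ∑ s, f s := by
  induction n with
  | zero => rfl
  | succ n ih => rw [Function.iterate_succ_apply', T_sum hK hb, ih]

/-- Every state reaches every other state in six steps. -/
def Reach (step : S → K → S) : Prop := ∀ s s' : S, ∃ y1 y2 y3 y4 y5 y6 : K,
  step (step (step (step (step (step s y1) y2) y3) y4) y5) y6 = s'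

lemma T_six [Nonempty S] (hK : Fintype.card K = 4) (hr : Reach step) {f : S → ℝ} {A d : ℝ}
    (hA : ∑ s, f s = Fintype.card S * A) (hf : ∀ s, A - d ≤ f s) (s : S) :
    A - (1 - 1 / 4 ^ 6) * d ≤ (T step)^[6] f s := by
  obtain ⟨s', -, hs'⟩ : ∃ s' ∈ (Finset.univ : Finset S), A ≤ f s' :=
    Finset.exists_le_of_sum_le (f := fun _ => A) Finset.univ_nonempty (by simp [hA])
  obtain ⟨y1, y2, y3, y4, y5, y6, rfl⟩ := hr s s'
  have key : ∀ n s y, ((T step)^[n] f (step s y) - (A - d)) / 4 ≤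
      (T step)^[n+1] f s - (A - d) := by
    intro n s y
    rw [Function.iterate_succ_apply']
    exact T_reach hK (T_iter_lb hK hf n) s y
  have h1 := key 5 s y1
  have h2 := key 4 (step s y1) y2
  have h3 := key 3 (step (step s y1) y2) y3
  have h4 := key 2 (step (step (step s y1) y2) y3) y4
  have h5 := key 1 (step (step (step (step s y1) y2) y3) y4) y5
  have h6 := key 0 (step (step (step (step (step s y1) y2) y3) y4) y5) y6
  norm_num only [Function.iterate_zero, id] at h1 h2 h3 h4 h5 h6 ⊢
  linarith

lemma T_six_mul [Nonempty S] (hK : Fintype.card K = 4) (hr : Reach step)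
    (hb : ∀ y, Function.Bijective (fun s => step s y)) {f : S → ℝ} {A d : ℝ}
    (hA : ∑ s, f s = Fintype.card S * A) (hf : ∀ s, A - d ≤ f s) (q : ℕ) :
    ∀ s, A - (1 - 1 / 4 ^ 6) ^ q * d ≤ (T step)^[6 * q] f s := by
  induction q with
  | zero => simpa using hf
  | succ q ih =>
    intro s
    rw [Nat.mul_succ, Nat.add_comm (6 * q) 6, Function.iterate_add_apply, pow_succ' _ q, mul_assoc]
    exact T_six hK hr (by rw [T_iter_sum hK hb, hA]) ih s

lemma T_lower [Nonempty S] (hK : Fintype.card K = 4) (hr : Reach step)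
    (hb : ∀ y, Function.Bijective (fun s => step s y)) {f : S → ℝ} {A d : ℝ}
    (hA : ∑ s, f s = Fintype.card S * A) (hf : ∀ s, A - d ≤ f s) (n : ℕ) (s : S) :
    A - (1 - 1 / 4 ^ 6) ^ (n / 6) * d ≤ (T step)^[n] f s := by
  have h := T_six_mul hK hr hb (f := (T step)^[n % 6] f)
    (by rw [T_iter_sum hK hb, hA]) (T_iter_lb hK hf (n % 6)) (n / 6) s
  rwa [← Function.iterate_add_apply, Nat.div_add_mod] at h

lemma T_tendsto [Nonempty S] (hK : Fintype.card K = 4) (hr : Reach step)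
    (hb : ∀ y, Function.Bijective (fun s => step s y)) {f : S → ℝ} {A : ℝ}
    (hA : ∑ s, f s = Fintype.card S * A) (s : S) :
    Tendsto (fun n => (T step)^[n] f s) atTop (𝓝 A) := by
  obtain ⟨d, hd⟩ : ∃ d, ∀ s, |f s - A| ≤ d :=
    ⟨∑ s, |f s - A|, fun s => Finset.single_le_sum (f := fun s => |f s - A|)
      (fun _ _ => abs_nonneg _) (Finset.mem_univ s)⟩
  have h1 := fun n => T_lower hK hr hb hA (d := d) (fun s => by have := abs_le.1 (hd s); linarith) n s
  have h2 := fun n => T_lower hK hr hb (f := -f) (A := -A) (by simp [hA]) (d := d)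
    (fun s => by have := abs_le.1 (hd s); simp only [Pi.neg_apply]; linarith) n s
  have h0 : Tendsto (fun n : ℕ => (1 - 1 / 4 ^ 6 : ℝ) ^ (n / 6) * d) atTop (𝓝 0) := by
    have := (tendsto_pow_atTop_nhds_zero_of_lt_one (r := (1 - 1 / 4 ^ 6 : ℝ)) (by norm_num)
      (by norm_num)).comp (Nat.tendsto_div_const_atTop (n := 6) (by norm_num))
    simpa using this.mul_const d
  refine tendsto_of_tendsto_of_tendsto_of_le_of_le (by simpa using h0.const_sub A)
    (by simpa using h0.const_add A) h1 (fun n => ?_)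
  have := h2 n
  rw [T_iter_neg] at this
  simp only [Pi.neg_apply] at this
  show _ ≤ A + _
  linarith

end walk

section field
variable {K : Type*} [Field K]

lemma evalE_cons {n : ℕ} (k : ℕ) (y : K) (x : Fin n → K) :
    evalE (k+1) (Fin.cons y x : Fin (n+1) → K) = evalE (k+1) x + y * evalE k x := by
  have : Multiset.map (Fin.cons y x : Fin (n+1) → K) Finset.univ.val
      = y ::ₘ Multiset.map x Finset.univ.val := by
    simp [Fin.univ_succ]
  unfold evalE
  rw [this]
  simp only [Multiset.esymm, Multiset.powersetCard_cons, Multiset.map_add, Multiset.sum_add,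
    Multiset.map_map, Function.comp_def, Multiset.prod_cons, Multiset.sum_map_mul_left]

lemma evalE_zero {n : ℕ} (x : Fin n → K) : evalE 0 x = 1 := by
  simp [evalE, Multiset.esymm]

lemma evalE_nil (k : ℕ) (x : Fin 0 → K) : evalE (k+1) x = 0 := by
  simp [evalE, Multiset.esymm, Multiset.powersetCard_zero_right]

variable [DecidableEq K]

def stp (s : K × K × Bool) (y : K) : K × K × Bool :=
  (s.1 + y, s.2.1 + y * s.1, xor s.2.2 (decide (y ≠ 0)))

def bit (b : Bool) : K := if b then 1 else 0

def c3 (s : K × K × Bool) : K := s.1 ^ 3 + s.1 * s.2.1 + bit s.2.2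

variable [Fintype K]

lemma two_zero (hK : Fintype.card K = 4) : (2 : K) = 0 := by
  have h : ((4 : ℕ) : K) = 0 := by rw [← hK]; exact Nat.cast_card_eq_zero K
  have : (2 : K) * 2 = 0 := by rw [← h]; norm_num
  simpa using this

lemma cube (hK : Fintype.card K = 4) (y : K) : y ^ 3 = bit (decide (y ≠ 0)) := by
  by_cases h : y = 0
  · simp [h, bit]
  · have := FiniteField.pow_card_sub_one_eq_one y h
    rw [hK] at this
    simp [h, bit, this]

lemma bit_xor (hK : Fintype.card K = 4) (a b : Bool) : (bit (xor a b) : K) = bit a + bit b := by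
  have := two_zero hK
  cases a <;> cases b <;> simp [bit]
  linear_combination -this

lemma c3_stp (hK : Fintype.card K = 4) (s : K × K × Bool) (y : K) :
    c3 (stp s y) = c3 s + y * s.2.1 := by
  have h2 := two_zero hK
  simp only [c3, stp, bit_xor hK, ← cube hK]
  linear_combination (y ^ 3 + 2 * s.1 ^ 2 * y + 2 * s.1 * y ^ 2) * h2

lemma stp_bij (y : K) : Function.Bijective (fun s => stp s y) := by
  apply Finite.injective_iff_bijective.1
  rintro ⟨a, b, c⟩ ⟨a', b', c'⟩ h
  simp only [stp, Prod.mk.injEq] at h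
  obtain ⟨h1, h2, h3⟩ := h
  have h1 : a = a' := by simpa using h1
  subst h1
  have h2 : b = b' := by simpa using h2
  have h3 : c = c' := by
    revert h3; cases c <;> cases c' <;> simp
  rw [h2, h3]

lemma reach (hK : Fintype.card K = 4) (α : K) (hα : α ^ 2 + α + 1 = 0) :
    Reach (stp (K := K)) := by
  have h2 := two_zero hK
  have hp : ∀ y : K, y ^ 4 = y := fun y => by
    have := FiniteField.pow_card y; rwa [hK] at this
  have h0 : α ≠ 0 := by rintro rfl; simp at hα
  have h1 : α + 1 ≠ 0 := by intro h; apply one_ne_zero (α := K); linear_combination hα - α * h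
  rintro ⟨a, b, c⟩ ⟨a', b', c'⟩
  obtain ⟨y, hy⟩ : ∃ y, y = a + a' := ⟨_, rfl⟩
  obtain ⟨z, hz⟩ : ∃ z, z = (b' + (b + y * a)) ^ 2 := ⟨_, rfl⟩
  have hz2 : z ^ 2 = b' + (b + y * a) := by rw [hz, ← pow_mul, hp]
  by_cases hc : xor c (decide (y ≠ 0)) = c'
  · refine ⟨y, z, z, 0, 0, 0, ?_⟩
    simp only [stp, Prod.mk.injEq]
    refine ⟨?_, ?_, ?_⟩
    · rw [hy]; linear_combination (z + a) * h2
    · linear_combination hz2 + (b + y * a + z * a + z * y) * h2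
    · rw [← hc]; simp
  · refine ⟨y, z, z, 1, α, α + 1, ?_⟩
    simp only [stp, Prod.mk.injEq]
    refine ⟨?_, ?_, ?_⟩
    · rw [hy]; linear_combination (z + a + α + 1) * h2
    · linear_combination hz2 + hα + (b + y * a + z * a + z * y + α + (a + y + 2 * z) * (1 + α)) * h2
    · revert hc
      generalize decide (y ≠ 0) = p
      simp only [ne_eq, h0, h1, one_ne_zero, not_false_eq_true, decide_true]
      generalize decide (¬ z = 0) = r
      cases c <;> cases c' <;> cases p <;> cases r <;> simp

noncomputable def ind (β : K) (s : K × K × Bool) : ℝ := if c3 s = β then 1 else 0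

lemma count_eq (hK : Fintype.card K = 4) (β : K) (n : ℕ) : ∀ s : K × K × Bool,
    ((Finset.univ.filter (fun x : Fin n → K =>
      c3 s + s.2.1 * evalE 1 x + s.1 * evalE 2 x + evalE 3 x = β)).card : ℝ) / 4 ^ n
      = (T stp)^[n] (ind β) s := by
  induction n with
  | zero =>
    intro s
    simp only [evalE_nil, Finset.natCast_card_filter]
    simp [ind]
  | succ n ih =>
    intro s
    rw [Function.iterate_succ_apply']
    simp only [T, ← ih, Finset.natCast_card_filter]
    rw [← (Fin.consEquiv (fun _ => K)).sum_comp, Fintype.sum_prod_type, ← Finset.sum_div,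
      div_div, ← pow_succ]
    congr 1
    refine Finset.sum_congr rfl fun y _ => Finset.sum_congr rfl fun x _ => ?_
    simp only [Fin.consEquiv, Equiv.coe_fn_mk, evalE_cons, evalE_zero, c3_stp hK]
    congr 2
    simp only [stp]
    ring

lemma count2 (hK : Fintype.card K = 4) (G : K → K → K) (γ : K) (n m : ℕ) (hm : m = n + 2)
    (i j : Fin m) (hi : i.val = 0) (hj : j.val = 1) :
    ((Finset.univ.filter (fun x : Fin m → K => evalE 3 x + G (x i) (x j) = γ)).card : ℝ) / 4 ^ m
    = (∑ u, ∑ v, (T stp)^[n] (ind (γ - G u v)) (stp (stp (0, 0, false) u) v)) / 16 := by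
  subst hm
  have hi : i = 0 := Fin.ext hi
  have hj : j = Fin.succ 0 := Fin.ext hj
  subst hi hj
  simp only [← count_eq hK, Finset.natCast_card_filter]
  rw [← (Fin.consEquiv (fun _ => K)).sum_comp, Fintype.sum_prod_type]
  simp only [← Finset.sum_div]
  rw [div_div, pow_add]
  norm_num only
  congr 1
  refine Finset.sum_congr rfl fun u _ => ?_
  rw [← (Fin.consEquiv (fun _ => K)).sum_comp, Fintype.sum_prod_type]
  refine Finset.sum_congr rfl fun v _ => Finset.sum_congr rfl fun x _ => ?_
  simp only [Fin.consEquiv, Equiv.coe_fn_mk, Fin.cons_zero, Fin.cons_succ, evalE_cons, evalE_zero,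
    c3_stp hK]
  congr 1
  rw [eq_sub_iff_add_eq]
  simp only [stp, c3, bit]
  congr 1
  simp
  ring

lemma ind_sum (hK : Fintype.card K = 4) (β : K) :
    ∑ s, ind β s = 6 + 4 * ((if β = 0 then 1 else 0) + if β = 1 then 1 else 0) := by
  have key : ∀ a : K, ∑ b : K, ∑ c : Bool, ind β (a, b, c) =
      2 + (if a = 0 then -2 + 4 * ((if β = 0 then 1 else 0) + if β = 1 then (1:ℝ) else 0) else 0) := by
    intro a
    by_cases ha : a = 0
    · simp only [Fintype.sum_bool]
      simp [ha, ind, c3, bit, hK, eq_comm]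
      split_ifs <;> norm_num
    · have h : ∀ b δ : K, a ^ 3 + a * b + δ = β ↔ b = (β - δ - a ^ 3) / a := by
        intro b δ
        rw [eq_div_iff ha]
        constructor <;> intro h <;> linear_combination h
      rw [Finset.sum_comm]
      simp [ind, c3, ha, h]
  simp only [Fintype.sum_prod_type, key, Finset.sum_add_distrib]
  simp [hK]; ring

lemma tends (hK : Fintype.card K = 4) (α : K) (hα : α ^ 2 + α + 1 = 0) (β : K)
    (s : K × K × Bool) : Tendsto (fun n => (T stp)^[n] (ind β) s) atTop
      (𝓝 ((6 + 4 * ((if β = 0 then 1 else 0) + if β = 1 then 1 else 0)) / 32)) := by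
  refine T_tendsto hK (reach hK α hα) stp_bij ?_ s
  rw [ind_sum hK]
  simp [hK]; ring

lemma univ_eq (hK : Fintype.card K = 4) (α : K) (hα : α ^ 2 + α + 1 = 0) :
    (Finset.univ : Finset K) = {0, 1, α, α + 1} ∧ α ≠ 0 ∧ α ≠ 1 ∧ α + 1 ≠ 0 := by
  have h2 := two_zero hK
  have h0 : α ≠ 0 := by rintro rfl; simp at hα
  have h1 : α + 1 ≠ 0 := by intro h; apply one_ne_zero (α := K); linear_combination hα - α * h
  have h3 : α ≠ 1 := by
    rintro rfl; apply one_ne_zero (α := K); linear_combination hα - h2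
  refine ⟨?_, h0, h3, h1⟩
  symm
  rw [← Finset.card_eq_iff_eq_univ, hK, Finset.card_insert_of_notMem, Finset.card_insert_of_notMem,
    Finset.card_insert_of_notMem, Finset.card_singleton]
  · simp
  · simp [h3.symm, h0]
  · simp [h0.symm, h1.symm]

lemma sum_K (hK : Fintype.card K = 4) (α : K) (hα : α ^ 2 + α + 1 = 0) {M : Type*}
    [AddCommMonoid M] (f : K → M) : ∑ u, f u = f 0 + (f 1 + (f α + f (α + 1))) := by
  obtain ⟨h, h0, h3, h1⟩ := univ_eq hK α hα
  rw [h, Finset.sum_insert, Finset.sum_insert, Finset.sum_insert, Finset.sum_singleton]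
  · simp
  · simp [h3.symm, h0]
  · simp [h0.symm, h1.symm]

def FF (u v : K) : K := u ^ 3 * v ^ 3 + v ^ 2 + u ^ 2

lemma FF_sum (hK : Fintype.card K = 4) (α : K) (hα : α ^ 2 + α + 1 = 0) {M : Type*}
    [AddCommMonoid M] (f : K → M) : ∑ u, ∑ v, f (FF u v) =
      3 • f 0 + 5 • f 1 + 4 • f α + 4 • f (α + 1) := by
  have h2 := two_zero hK
  have a2 : α ^ 2 = α + 1 := by linear_combination hα - (α + 1) * h2
  have a3 : α ^ 3 = 1 := by linear_combination (α - 1) * hα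
  have b2 : (α + 1) ^ 2 = α := by linear_combination hα
  have b3 : (α + 1) ^ 3 = 1 := by linear_combination (α + 2) * hα - h2
  have e : (1 : K) + 1 = 0 := by linear_combination h2
  have e1 : (α : K) + 1 + 1 = α := by linear_combination h2
  have e2 : (1 : K) + α = α + 1 := by ring
  have e3 : α + α = 0 := by linear_combination α * h2
  have e4 : α + (α + 1) = 1 := by linear_combination α * h2
  have e5 : (α + 1) + α = 1 := by linear_combination α * h2
  have e6 : (α + 1) + (α + 1) = 0 := by linear_combination (α + 1) * h2
  have e7 : 1 + (α + 1) = α := by linear_combination h2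
  simp only [sum_K hK α hα, FF, a2, a3, b2, b3, one_pow, ne_eq, OfNat.ofNat_ne_zero,
    not_false_eq_true, zero_pow, zero_mul, mul_zero, mul_one, zero_add, add_zero, e, e1, e2, e3,
    e4, e5, e6, e7]
  abel

lemma FF_card (hK : Fintype.card K = 4) (α : K) (hα : α ^ 2 + α + 1 = 0) (t : K) :
    (Finset.univ.filter (fun x : Fin 2 → K =>
        (x 0) ^ 3 * (x 1) ^ 3 + (x 1) ^ 2 + (x 0) ^ 2 = t)).card =
    3 * (if 0 = t then 1 else 0) + 5 * (if 1 = t then 1 else 0) + 4 * (if α = t then 1 else 0) +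
      4 * (if α + 1 = t then 1 else 0) := by
  have := FF_sum hK α hα (fun w => if w = t then 1 else 0)
  simp only [smul_eq_mul] at this
  rw [← this, Finset.card_filter, ← (finTwoArrowEquiv K).symm.sum_comp, Fintype.sum_prod_type]
  rfl

end field
end F4aux

/-- Over `𝔽_4 = 𝔽_2(α)` with `α² + α + 1 = 0`, the function
`F(x₁,x₂) = x₁³x₂³ + x₂² + x₁²` is not balanced (taking values `0,1,α,α+1` exactly
`3,5,4,4` times), `e_3` is not asymptotically balanced, and yet the perturbation
`e_{n,3} + F` is asymptotically balanced. -/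
theorem counterexample_F4_e3 (K : Type*) [Field K] [Fintype K] [DecidableEq K]
    (hK : Fintype.card K = 4) (α : K) (hα : α ^ 2 + α + 1 = 0) :
    ((Finset.univ.filter (fun x : Fin 2 → K =>
        (x 0) ^ 3 * (x 1) ^ 3 + (x 1) ^ 2 + (x 0) ^ 2 = 0)).card = 3 ∧
     (Finset.univ.filter (fun x : Fin 2 → K =>
        (x 0) ^ 3 * (x 1) ^ 3 + (x 1) ^ 2 + (x 0) ^ 2 = 1)).card = 5 ∧
     (Finset.univ.filter (fun x : Fin 2 → K =>
        (x 0) ^ 3 * (x 1) ^ 3 + (x 1) ^ 2 + (x 0) ^ 2 = α)).card = 4 ∧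
     (Finset.univ.filter (fun x : Fin 2 → K =>
        (x 0) ^ 3 * (x 1) ^ 3 + (x 1) ^ 2 + (x 0) ^ 2 = α + 1)).card = 4 ∧
     ¬ ∀ t : K, (Finset.univ.filter (fun x : Fin 2 → K =>
        (x 0) ^ 3 * (x 1) ^ 3 + (x 1) ^ 2 + (x 0) ^ 2 = t)).card = 4) ∧
    (¬ ∀ β : K,
      Tendsto
        (fun n : ℕ =>
          ((Finset.univ.filter (fun x : Fin n → K => evalE 3 x = β)).card : ℝ) / (4 : ℝ) ^ n)
        atTop (𝓝 (1 / 4))) ∧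
    (∀ γ : K,
      Tendsto
        (fun n : ℕ =>
          ((Finset.univ.filter (fun x : Fin (2 + n) → K =>
              evalE 3 x +
                ((x (Fin.castAdd n 0)) ^ 3 * (x (Fin.castAdd n 1)) ^ 3 +
                  (x (Fin.castAdd n 1)) ^ 2 + (x (Fin.castAdd n 0)) ^ 2) = γ)).card : ℝ) /
            (4 : ℝ) ^ (2 + n))
        atTop (𝓝 (1 / 4))) := by
  classical
  have h2 := F4aux.two_zero hK
  obtain ⟨hu, h0, h3, h1⟩ := F4aux.univ_eq hK α hα
  refine ⟨?_, ?_, ?_⟩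
  · simp only [F4aux.FF_card hK α hα]
    refine ⟨?_, ?_, ?_, ?_, ?_⟩
    · simp [h0, h1]
    · simp [h0, h3]
    · simp [h0.symm, h3.symm]
    · simp [h1.symm, h0]
    · intro h
      have := h 0
      simp [h0, h1] at this
  · intro h
    have ha := h 0
    have hb := F4aux.tends hK α hα 0 (0, 0, false)
    simp only [← F4aux.count_eq hK] at hb
    simp only [F4aux.c3, F4aux.bit] at hb
    have := tendsto_nhds_unique ha (by simpa using hb)
    norm_num at this
  · intro γ
    have hc := fun n => F4aux.count2 hK F4aux.FF γ n (2 + n) (Nat.add_comm 2 n)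
      (Fin.castAdd n 0) (Fin.castAdd n 1) rfl rfl
    refine Tendsto.congr (fun n => (hc n).symm) ?_
    have hl := (tendsto_finset_sum Finset.univ fun u _ => tendsto_finset_sum Finset.univ fun v _ =>
      F4aux.tends hK α hα (γ - F4aux.FF u v)
        (F4aux.stp (F4aux.stp (0, 0, false) u) v)).div_const 16
    convert hl using 2
    rw [F4aux.FF_sum hK α hα (fun w => ((6 + 4 * ((if γ - w = 0 then 1 else 0) +
      if γ - w = 1 then 1 else 0)) / 32 : ℝ))]
    have e1 : (α : K) + 1 + 1 = α := by linear_combination h2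
    have e2 : (1 : K) + α = α + 1 := by ring
    have e4 : (1 : K) + 1 = 0 := by linear_combination h2
    have e5 : 1 + (α + 1) = α := by linear_combination h2
    have hγ : γ ∈ (Finset.univ : Finset K) := Finset.mem_univ γ
    rw [hu] at hγ
    simp only [Finset.mem_insert, Finset.mem_singleton] at hγ
    simp only [sub_eq_iff_eq_add, zero_add, add_zero, e2, e4, e5]
    rcases hγ with rfl | rfl | rfl | rfl
    · simp [h0.symm, h1.symm]; norm_num
    · simp [h0, h3.symm]; norm_num
    · simp [h0, h3]; norm_num
    · simp [h0, h1]; norm_num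
end

section
/- Let 𝔽_4 be a field with 4 elements and α ∈ 𝔽_4 with α² + α + 1 = 0. Then as n → ∞, the real sequence (1/4^n) · #{x ∈ 𝔽_4^n : e_3(x) = β} converges to 5/16 for β ∈ {0, 1}, and converges to 3/16 for β ∈ {α, α+1}. -/
open Filter Topology

abbrev F4m := ZMod 2 × ZMod 2
def mulF (u v : F4m) : F4m := (u.1 * v.1 + u.2 * v.2, u.1 * v.2 + u.2 * v.1 + u.2 * v.2)
def stepF (x : F4m) (s : F4m × F4m × F4m) : F4m × F4m × F4m :=
  (s.1 + x, s.2.1 + mulF x s.1, s.2.2 + mulF x s.2.1)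
abbrev G64 := ZMod 4 × ZMod 4 × ZMod 4
def gF (x : F4m) : G64 :=
  if x = (0, 0) then (0, 0, 0) else if x = (1, 0) then (1, 0, 0)
  else if x = (0, 1) then (0, 1, 0) else (0, 0, 1)
def stateF (v : G64) : F4m × F4m × F4m :=
  (stepF (1, 0))^[v.1.val] ((stepF (0, 1))^[v.2.1.val] ((stepF (1, 1))^[v.2.2.val] 0))
theorem stateF_add : ∀ (x : F4m) (v : G64), stateF (gF x + v) = stepF x (stateF v) := by
  decide +kernel
theorem count_stateF : ∀ b : F4m, (Finset.univ.filter (fun v : G64 => (stateF v).2.2 = b)).card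
    = if b.2 = 0 then 20 else 12 := by
  decide +kernel

theorem norm_one_add_lt {z : ℂ} (hz : ‖z‖ = 1) (h1 : z ≠ 1) : ‖1 + z‖ < 2 := by
  have h2 : z.re * z.re + z.im * z.im = 1 := by
    rw [← Complex.normSq_apply, Complex.normSq_eq_norm_sq, hz]; norm_num
  have h3 : z.re < 1 := by
    rcases lt_or_ge z.re 1 with h | h
    · exact h
    · exfalso; apply h1
      have him : z.im = 0 := by nlinarith [mul_self_nonneg z.im]
      have hre : z.re = 1 := by nlinarith [mul_self_nonneg z.im]
      exact Complex.ext (by simpa using hre) (by simpa using him)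
  have h4 : ‖1 + z‖ ^ 2 < 4 := by
    rw [← Complex.normSq_eq_norm_sq, Complex.normSq_apply]
    simp only [Complex.add_re, Complex.one_re, Complex.add_im, Complex.one_im]
    nlinarith
  nlinarith [norm_nonneg (1 + z)]

theorem norm_four_lt {a b c : ℂ} (ha : ‖a‖ = 1) (hb : ‖b‖ = 1) (hc : ‖c‖ = 1)
    (h : ¬ (a = 1 ∧ b = 1 ∧ c = 1)) : ‖1 + a + b + c‖ < 4 := by
  have key : ∀ a b c : ℂ, ‖b‖ = 1 → ‖c‖ = 1 → ‖a‖ = 1 → a ≠ 1 → ‖1 + a + b + c‖ < 4 := by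
    intro a b c hb hc ha h1
    have := norm_one_add_lt ha h1
    have h2 := norm_add_le (1 + a + b) c
    have h3 := norm_add_le (1 + a) b
    linarith
  by_cases h1 : a = 1
  · by_cases h2 : b = 1
    · have h3 : c ≠ 1 := fun h3 => h ⟨h1, h2, h3⟩
      have := key c a b ha hb hc h3
      rwa [show 1 + c + a + b = 1 + a + b + c by ring] at this
    · have := key b a c ha hc hb h2
      rwa [show 1 + b + a + c = 1 + a + b + c by ring] at this
  · exact key a b c hb hc ha h1

theorem sum_gF (ψ : G64 → ℂ) :
    ∑ x : F4m, ψ (gF x) = ψ (0, 0, 0) + ψ (1, 0, 0) + ψ (0, 1, 0) + ψ (0, 0, 1) := by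
  have hu : (Finset.univ : Finset F4m) = {(0, 0), (1, 0), (0, 1), (1, 1)} := by decide
  rw [hu, Finset.sum_insert (by decide), Finset.sum_insert (by decide),
    Finset.sum_insert (by decide), Finset.sum_singleton]
  have h0 : gF (0, 0) = (0, 0, 0) := by decide
  have h1 : gF (1, 0) = (1, 0, 0) := by decide
  have h2 : gF (0, 1) = (0, 1, 0) := by decide
  have h3 : gF (1, 1) = (0, 0, 1) := by decide
  rw [h0, h1, h2, h3]; ring

theorem G64_decomp : ∀ v : G64, v = v.1.val • ((1, 0, 0) : G64) + v.2.1.val • ((0, 1, 0) : G64)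
    + v.2.2.val • ((0, 0, 1) : G64) := by
  decide +kernel

theorem addChar_eq_zero (ψ : AddChar G64 ℂ) (h : ψ (1, 0, 0) = 1 ∧ ψ (0, 1, 0) = 1 ∧
    ψ (0, 0, 1) = 1) : ψ = 0 := by
  ext v
  rw [G64_decomp v, AddChar.map_add_eq_mul, AddChar.map_add_eq_mul, AddChar.map_nsmul_eq_pow,
    AddChar.map_nsmul_eq_pow, AddChar.map_nsmul_eq_pow, h.1, h.2.1, h.2.2]
  simp

theorem addChar_map_sum_s11 {n : ℕ} (ψ : AddChar G64 ℂ) (y : Fin n → G64) :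
    ψ (∑ i, y i) = ∏ i, ψ (y i) := by
  induction n with
  | zero => simp
  | succ n ih => rw [Fin.sum_univ_succ, Fin.prod_univ_succ, AddChar.map_add_eq_mul, ih]

theorem tendsto_char (ψ : AddChar G64 ℂ) :
    Tendsto (fun n : ℕ => (∑ y : Fin n → F4m, ψ (∑ i, gF (y i))) / (4 : ℂ) ^ n) atTop
      (𝓝 ((∑ v, ψ v) / 64)) := by
  have hs : ∀ n : ℕ, (∑ y : Fin n → F4m, ψ (∑ i, gF (y i))) / (4 : ℂ) ^ n
      = ((1 + ψ (1, 0, 0) + ψ (0, 1, 0) + ψ (0, 0, 1)) / 4) ^ n := by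
    intro n
    have h0 : ψ (0, 0, 0) = 1 := ψ.map_zero_eq_one
    rw [div_pow, ← h0, ← sum_gF, Fintype.sum_pow]
    simp only [addChar_map_sum_s11]
  simp only [hs]
  classical
  rw [AddChar.sum_eq_ite]
  by_cases hψ : ψ = 0
  · subst hψ
    have : Fintype.card G64 = 64 := by simp [G64]
    rw [if_pos rfl, this]
    simp
    norm_num
  · rw [if_neg hψ, zero_div]
    apply tendsto_pow_atTop_nhds_zero_of_norm_lt_one
    rw [norm_div]
    have := norm_four_lt (ψ.norm_apply (1, 0, 0)) (ψ.norm_apply (0, 1, 0)) (ψ.norm_apply (0, 0, 1))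
      (fun h => hψ (addChar_eq_zero ψ h))
    have h4 : ‖(4 : ℂ)‖ = 4 := by norm_num
    rw [h4]; linarith

theorem tendsto_fun (f : G64 → ℂ) :
    Tendsto (fun n : ℕ => (∑ y : Fin n → F4m, f (∑ i, gF (y i))) / (4 : ℂ) ^ n) atTop
      (𝓝 ((∑ v, f v) / 64)) := by
  have hf : f ∈ Submodule.span ℂ (Set.range (AddChar.complexBasis G64)) := by
    rw [(AddChar.complexBasis G64).span_eq]; trivial
  induction hf using Submodule.span_induction with
  | mem f hf =>
    obtain ⟨ψ, rfl⟩ := hf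
    rw [AddChar.complexBasis_apply]
    exact tendsto_char ψ
  | zero => simp
  | add f g _ _ hf hg =>
    have := hf.add hg
    simpa only [Pi.add_apply, Finset.sum_add_distrib, add_div] using this
  | smul c f _ hf =>
    have := hf.const_mul c
    simpa only [Pi.smul_apply, smul_eq_mul, ← Finset.mul_sum, mul_div_assoc] using this

theorem tendsto_count_s11 (b : F4m) :
    Tendsto (fun n : ℕ => ((Finset.univ.filter
      (fun y : Fin n → F4m => (stateF (∑ i, gF (y i))).2.2 = b)).card : ℝ) / (4 : ℝ) ^ n) atTop
      (𝓝 ((if b.2 = 0 then 5 else 3) / 16)) := by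
  have h := tendsto_fun (fun v => if (stateF v).2.2 = b then 1 else 0)
  simp only [Finset.sum_boole] at h
  rw [count_stateF] at h
  have h2 := (Complex.continuous_re.tendsto _).comp h
  have e1 : ((((if b.2 = 0 then 20 else 12 : ℕ) : ℂ)) / 64).re
      = (if b.2 = 0 then 5 else 3) / 16 := by
    split_ifs <;> norm_num
  rw [e1] at h2
  refine h2.congr fun n => ?_
  simp only [Function.comp]
  rw [← Complex.ofReal_re (((Finset.univ.filter
      (fun y : Fin n → F4m => (stateF (∑ i, gF (y i))).2.2 = b)).card : ℝ) / (4 : ℝ) ^ n)]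
  push_cast
  rfl

theorem evalE_succ {K : Type*} [CommSemiring K] {n : ℕ} (k : ℕ) (x : Fin (n + 1) → K) :
    evalE (k + 1) x = evalE (k + 1) (fun i => x i.succ) + x 0 * evalE k (fun i => x i.succ) := by
  unfold evalE
  rw [Fin.univ_succ, Finset.cons_val, Multiset.map_cons, Finset.map_val, Multiset.map_map]
  simp only [Multiset.esymm, Multiset.powersetCard_cons, Multiset.map_add, Multiset.sum_add,
    Multiset.map_map]
  congr 1
  rw [← Multiset.sum_map_mul_left]
  simp [Function.comp_def]

def phiF {K : Type*} [Field K] (α : K) (u : F4m) : K :=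
  (if u.1 = 0 then 0 else 1) + (if u.2 = 0 then 0 else α)

theorem zmod2_cases : ∀ a : ZMod 2, a = 0 ∨ a = 1 := by decide

section
variable {K : Type*} [Field K]

theorem phiF_add (h2 : (2 : K) = 0) (α : K) (u v : F4m) :
    phiF α (u + v) = phiF α u + phiF α v := by
  obtain ⟨a, b⟩ := u
  obtain ⟨c, d⟩ := v
  rcases zmod2_cases a with rfl | rfl <;> rcases zmod2_cases b with rfl | rfl <;>
    rcases zmod2_cases c with rfl | rfl <;> rcases zmod2_cases d with rfl | rfl <;>
    simp [phiF, show (1 : ZMod 2) + 1 = 0 from rfl] <;> grind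

theorem phiF_mul (h2 : (2 : K) = 0) (α : K) (hα : α ^ 2 + α + 1 = 0) (u v : F4m) :
    phiF α (mulF u v) = phiF α u * phiF α v := by
  obtain ⟨a, b⟩ := u
  obtain ⟨c, d⟩ := v
  rcases zmod2_cases a with rfl | rfl <;> rcases zmod2_cases b with rfl | rfl <;>
    rcases zmod2_cases c with rfl | rfl <;> rcases zmod2_cases d with rfl | rfl <;>
    simp [phiF, mulF, show (1 : ZMod 2) + 1 = 0 from rfl] <;> grind

theorem phiF_inj (h2 : (2 : K) = 0) (α : K) (hα : α ^ 2 + α + 1 = 0) :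
    Function.Injective (phiF α) := by
  rintro ⟨a, b⟩ ⟨c, d⟩ h
  rcases zmod2_cases a with rfl | rfl <;> rcases zmod2_cases b with rfl | rfl <;>
    rcases zmod2_cases c with rfl | rfl <;> rcases zmod2_cases d with rfl | rfl <;>
    simp [phiF] at h ⊢ <;> grind

theorem evalE_zero' {n : ℕ} (x : Fin n → K) : evalE 0 x = 1 := by
  simp [evalE, Multiset.esymm]

theorem evalE_state (h2 : (2 : K) = 0) (α : K) (hα : α ^ 2 + α + 1 = 0) {n : ℕ}
    (y : Fin n → F4m) :
    evalE 1 (fun i => phiF α (y i)) = phiF α (stateF (∑ i, gF (y i))).1 ∧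
    evalE 2 (fun i => phiF α (y i)) = phiF α (stateF (∑ i, gF (y i))).2.1 ∧
    evalE 3 (fun i => phiF α (y i)) = phiF α (stateF (∑ i, gF (y i))).2.2 := by
  induction n with
  | zero =>
    have : stateF 0 = 0 := by decide
    simp [this, phiF, evalE, Multiset.esymm, Multiset.powersetCard_zero_right]
  | succ n ih =>
    obtain ⟨i1, i2, i3⟩ := ih (fun i => y i.succ)
    rw [Fin.sum_univ_succ, stateF_add]
    simp only [stepF, phiF_add h2, phiF_mul h2 α hα]
    refine ⟨?_, ?_, ?_⟩
    · rw [evalE_succ, evalE_zero', i1, mul_one]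
    · rw [evalE_succ, i1, i2]
    · rw [evalE_succ, i2, i3]

theorem tendsto_K [Fintype K] [DecidableEq K] (hK : Fintype.card K = 4) (h2 : (2 : K) = 0)
    (α : K) (hα : α ^ 2 + α + 1 = 0) (b : F4m) :
    Tendsto (fun n : ℕ =>
        ((Finset.univ.filter (fun x : Fin n → K => evalE 3 x = phiF α b)).card : ℝ) / (4 : ℝ) ^ n)
      atTop (𝓝 ((if b.2 = 0 then 5 else 3) / 16)) := by
  have hbij : Function.Bijective (phiF α) := by
    rw [Fintype.bijective_iff_injective_and_card]
    exact ⟨phiF_inj h2 α hα, by rw [hK]; rfl⟩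
  refine (tendsto_count_s11 b).congr fun n => ?_
  congr 2
  refine Finset.card_bij (fun y _ i => phiF α (y i)) ?_ ?_ ?_
  · intro y hy
    simp only [Finset.mem_filter, Finset.mem_univ, true_and] at hy ⊢
    rw [(evalE_state h2 α hα y).2.2, hy]
  · intro y _ z _ h
    funext i
    exact hbij.1 (congrFun h i)
  · intro x hx
    choose y hy using fun i => hbij.2 (x i)
    obtain rfl : (fun i => phiF α (y i)) = x := funext hy
    refine ⟨y, ?_, rfl⟩
    simp only [Finset.mem_filter, Finset.mem_univ, true_and] at hx ⊢
    rw [(evalE_state h2 α hα y).2.2] at hx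
    exact hbij.1 hx
end

/-- Over `𝔽_4 = 𝔽_2(α)` with `α² + α + 1 = 0`, the limiting value
distribution of `e_3` is `5/16` at `0` and `1`, and `3/16` at `α` and `α + 1`. -/
theorem limit_distribution_F4_e3 (K : Type*) [Field K] [Fintype K] [DecidableEq K]
    (hK : Fintype.card K = 4) (α : K) (hα : α ^ 2 + α + 1 = 0) :
    Tendsto (fun n : ℕ =>
        ((Finset.univ.filter (fun x : Fin n → K => evalE 3 x = 0)).card : ℝ) / (4 : ℝ) ^ n)
      atTop (𝓝 (5 / 16)) ∧
    Tendsto (fun n : ℕ =>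
        ((Finset.univ.filter (fun x : Fin n → K => evalE 3 x = 1)).card : ℝ) / (4 : ℝ) ^ n)
      atTop (𝓝 (5 / 16)) ∧
    Tendsto (fun n : ℕ =>
        ((Finset.univ.filter (fun x : Fin n → K => evalE 3 x = α)).card : ℝ) / (4 : ℝ) ^ n)
      atTop (𝓝 (3 / 16)) ∧
    Tendsto (fun n : ℕ =>
        ((Finset.univ.filter (fun x : Fin n → K => evalE 3 x = α + 1)).card : ℝ) / (4 : ℝ) ^ n)
      atTop (𝓝 (3 / 16)) := by
  have h2 : (2 : K) = 0 := by
    have h4 : ((Fintype.card K : ℕ) : K) = 0 := Nat.cast_card_eq_zero K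
    rw [hK] at h4
    push_cast at h4
    have : (2 : K) * 2 = 0 := by rw [← h4]; norm_num
    exact mul_self_eq_zero.mp this
  have H := tendsto_K hK h2 α hα
  refine ⟨?_, ?_, ?_, ?_⟩
  · simpa [phiF] using H (0, 0)
  · simpa [phiF] using H (1, 0)
  · simpa [phiF] using H (0, 1)
  · simpa [phiF, add_comm] using H (1, 1)
end
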